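/- Let K be a field of characteristic zero. The following are equivalent: (1) [Jacobian conjecture] every K-algebra endomorphism f of K[x,y] with Jac(f(x), f(y)) a nonzero element of K is a K-algebra automorphism; (2) [γ,δ conjecture] for every K-algebra endomorphism f of K[x,y] with Jac(f(x), f(y)) a nonzero element of K, there exist involutions γ and δ on K[x,y] such that f∘γ = δ∘f. -/

import Mathlib

open MvPolynomial

/-- The Jacobian of two polynomials in `K[x,y]` (variables indexed by `Fin 2`). -/
noncomputable def Jac {K : Type*} [CommRing K]
    (P Q : MvPolynomial (Fin 2) K) : MvPolynomial (Fin 2) K :=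
  pderiv 0 P * pderiv 1 Q - pderiv 1 P * pderiv 0 Q

/-- The exchange involution `α` on `K[x,y]`, swapping the two variables. -/
noncomputable def exch (K : Type*) [CommSemiring K] :
    MvPolynomial (Fin 2) K ≃ₐ[K] MvPolynomial (Fin 2) K :=
  MvPolynomial.renameEquiv K (Equiv.swap 0 1)

/-- An involution on a `K`-algebra: an algebra automorphism of order 2. -/
def IsInvolution {K R : Type*} [CommSemiring K] [Semiring R] [Algebra K R]
    (γ : R ≃ₐ[K] R) : Prop :=
  (∀ p, γ (γ p) = p) ∧ γ ≠ AlgEquiv.refl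


set_option linter.unusedSectionVars false
/-! ### Weights and degrees -/

/-- Weight of an exponent vector with respect to the weights `(t, 1)`. -/
noncomputable def wt (t : ℝ) (d : Fin 2 →₀ ℕ) : ℝ := t * (d 0 : ℝ) + (d 1 : ℝ)

theorem wt_add (t : ℝ) (d e : Fin 2 →₀ ℕ) : wt t (d + e) = wt t d + wt t e := by
  simp [wt]; ring

theorem wt_nsmul (t : ℝ) (n : ℕ) (d : Fin 2 →₀ ℕ) : wt t (n • d) = n * wt t d := by
  simp [wt]; ring

theorem wt_zero (t : ℝ) : wt t 0 = 0 := by simp [wt]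

theorem wt_nonneg {t : ℝ} (ht : 0 < t) (d : Fin 2 →₀ ℕ) : 0 ≤ wt t d := by
  unfold wt; positivity

theorem fin2_ext {d e : Fin 2 →₀ ℕ} (h0 : d 0 = e 0) (h1 : d 1 = e 1) : d = e := by
  ext i; fin_cases i <;> assumption

theorem wt_pos {t : ℝ} (ht : 0 < t) {d : Fin 2 →₀ ℕ} (hd : d ≠ 0) : 0 < wt t d := by
  rcases Nat.eq_zero_or_pos (d 0) with h0 | h0
  · rcases Nat.eq_zero_or_pos (d 1) with h1 | h1
    · exact absurd (fin2_ext (by simpa using h0) (by simpa using h1)) hd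
    · have : (0:ℝ) < d 1 := by exact_mod_cast h1
      unfold wt; positivity
  · have : (0:ℝ) < d 0 := by exact_mod_cast h0
    unfold wt; positivity

theorem wt_single0 (t : ℝ) (n : ℕ) : wt t (Finsupp.single 0 n) = t * n := by simp [wt]
theorem wt_single1 (t : ℝ) (n : ℕ) : wt t (Finsupp.single 1 n) = n := by simp [wt]

section basics
variable {K : Type*} [Field K]

/-- All monomials of `p` have weight at most `r`. -/
def LEw (t : ℝ) (p : MvPolynomial (Fin 2) K) (r : ℝ) : Prop := ∀ d, coeff d p ≠ 0 → wt t d ≤ r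
/-- All monomials of `p` have weight less than `r`. -/
def LTw (t : ℝ) (p : MvPolynomial (Fin 2) K) (r : ℝ) : Prop := ∀ d, coeff d p ≠ 0 → wt t d < r
/-- All monomials of `p` have weight exactly `r`. -/
def HOM (t : ℝ) (p : MvPolynomial (Fin 2) K) (r : ℝ) : Prop := ∀ d, coeff d p ≠ 0 → wt t d = r

theorem LTw.le {t : ℝ} {p : MvPolynomial (Fin 2) K} {r : ℝ} (h : LTw t p r) : LEw t p r :=
  fun d hd => (h d hd).le
theorem HOM.le {t : ℝ} {p : MvPolynomial (Fin 2) K} {r : ℝ} (h : HOM t p r) : LEw t p r :=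
  fun d hd => (h d hd).le
theorem LEw.mono {t : ℝ} {p : MvPolynomial (Fin 2) K} {r s : ℝ} (h : LEw t p r) (hrs : r ≤ s) :
    LEw t p s := fun d hd => (h d hd).trans hrs
theorem LTw.mono {t : ℝ} {p : MvPolynomial (Fin 2) K} {r s : ℝ} (h : LTw t p r) (hrs : r ≤ s) :
    LTw t p s := fun d hd => (h d hd).trans_le hrs
theorem LEw.lt {t : ℝ} {p : MvPolynomial (Fin 2) K} {r s : ℝ} (h : LEw t p r) (hrs : r < s) :
    LTw t p s := fun d hd => (h d hd).trans_lt hrs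

theorem coeff_add_ne {d} {p q : MvPolynomial (Fin 2) K} (h : coeff d (p + q) ≠ 0) :
    coeff d p ≠ 0 ∨ coeff d q ≠ 0 := by
  by_contra hh; push Not at hh; apply h; simp [hh]

theorem coeff_mul_ne {d} {p q : MvPolynomial (Fin 2) K} (h : coeff d (p * q) ≠ 0) :
    ∃ e f, e + f = d ∧ coeff e p ≠ 0 ∧ coeff f q ≠ 0 := by
  rw [coeff_mul] at h
  obtain ⟨⟨e, f⟩, hm, hne⟩ := Finset.exists_ne_zero_of_sum_ne_zero h
  exact ⟨e, f, by simpa using hm, left_ne_zero_of_mul hne, right_ne_zero_of_mul hne⟩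

variable {t : ℝ} {p q : MvPolynomial (Fin 2) K} {r s : ℝ}

theorem LEw.add (hp : LEw t p r) (hq : LEw t q r) : LEw t (p + q) r := fun d hd =>
  (coeff_add_ne hd).elim (hp d) (hq d)
theorem LTw.add (hp : LTw t p r) (hq : LTw t q r) : LTw t (p + q) r := fun d hd =>
  (coeff_add_ne hd).elim (hp d) (hq d)
theorem HOM.add (hp : HOM t p r) (hq : HOM t q r) : HOM t (p + q) r := fun d hd =>
  (coeff_add_ne hd).elim (hp d) (hq d)
theorem LEw.neg (hp : LEw t p r) : LEw t (-p) r := fun d hd => hp d (by simpa using hd)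
theorem LTw.neg (hp : LTw t p r) : LTw t (-p) r := fun d hd => hp d (by simpa using hd)
theorem HOM.neg (hp : HOM t p r) : HOM t (-p) r := fun d hd => hp d (by simpa using hd)
theorem LEw.sub (hp : LEw t p r) (hq : LEw t q r) : LEw t (p - q) r := by
  rw [sub_eq_add_neg]; exact hp.add hq.neg
theorem LTw.sub (hp : LTw t p r) (hq : LTw t q r) : LTw t (p - q) r := by
  rw [sub_eq_add_neg]; exact hp.add hq.neg
theorem HOM.sub (hp : HOM t p r) (hq : HOM t q r) : HOM t (p - q) r := by
  rw [sub_eq_add_neg]; exact hp.add hq.neg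
theorem LEw.mul (hp : LEw t p r) (hq : LEw t q s) : LEw t (p * q) (r + s) := fun d hd => by
  obtain ⟨e, f, rfl, he, hf⟩ := coeff_mul_ne hd
  rw [wt_add]; linarith [hp e he, hq f hf]
theorem LTw.mul_le (hp : LTw t p r) (hq : LEw t q s) : LTw t (p * q) (r + s) := fun d hd => by
  obtain ⟨e, f, rfl, he, hf⟩ := coeff_mul_ne hd
  rw [wt_add]; linarith [hp e he, hq f hf]
theorem LEw.mul_lt (hp : LEw t p r) (hq : LTw t q s) : LTw t (p * q) (r + s) := fun d hd => by
  obtain ⟨e, f, rfl, he, hf⟩ := coeff_mul_ne hd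
  rw [wt_add]; linarith [hp e he, hq f hf]
theorem HOM.mul (hp : HOM t p r) (hq : HOM t q s) : HOM t (p * q) (r + s) := fun d hd => by
  obtain ⟨e, f, rfl, he, hf⟩ := coeff_mul_ne hd
  rw [wt_add]; linarith [hp e he, hq f hf]
theorem HOM.zero : HOM t (0 : MvPolynomial (Fin 2) K) r := fun d hd => absurd (coeff_zero d) hd
theorem LTw.zero : LTw t (0 : MvPolynomial (Fin 2) K) r := fun d hd => absurd (coeff_zero d) hd
theorem LEw.zero : LEw t (0 : MvPolynomial (Fin 2) K) r := fun d hd => absurd (coeff_zero d) hd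

theorem HOM.monomial (d : Fin 2 →₀ ℕ) (c : K) : HOM t (MvPolynomial.monomial d c) (wt t d) :=
  fun e he => by
    classical
    rw [coeff_monomial] at he
    by_cases h : d = e
    · rw [h]
    · simp [h] at he
theorem HOM.C (c : K) : HOM t (MvPolynomial.C c) 0 := by
  have := HOM.monomial (t := t) 0 c
  rwa [wt_zero] at this
theorem HOM.one : HOM t (1 : MvPolynomial (Fin 2) K) 0 := by
  have := HOM.C (t := t) (1 : K)
  rwa [C_1] at this
theorem HOM.X0 : HOM t (MvPolynomial.X 0 : MvPolynomial (Fin 2) K) t := by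
  have := HOM.monomial (t := t) (Finsupp.single 0 1) (1 : K)
  rwa [wt_single0, Nat.cast_one, mul_one] at this
theorem HOM.X1 : HOM t (MvPolynomial.X 1 : MvPolynomial (Fin 2) K) 1 := by
  have := HOM.monomial (t := t) (Finsupp.single 1 1) (1 : K)
  rwa [wt_single1, Nat.cast_one] at this
theorem LEw.C_mul (c : K) (hp : LEw t p r) : LEw t (MvPolynomial.C c * p) r := by
  simpa using (HOM.C (t := t) c).le.mul hp
theorem LTw.C_mul (c : K) (hp : LTw t p r) : LTw t (MvPolynomial.C c * p) r := by
  simpa using (HOM.C (t := t) c).le.mul_lt hp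
theorem HOM.C_mul (c : K) (hp : HOM t p r) : HOM t (MvPolynomial.C c * p) r := by
  simpa using (HOM.C (t := t) c).mul hp
theorem LEw.pow (hp : LEw t p r) (n : ℕ) : LEw t (p ^ n) (n * r) := by
  induction n with
  | zero => simpa using (HOM.one (K := K) (t := t)).le
  | succ n ih => rw [pow_succ]; exact (ih.mul hp).mono (by push_cast; linarith)
theorem HOM.pow (hp : HOM t p r) (n : ℕ) : HOM t (p ^ n) (n * r) := by
  induction n with
  | zero => simpa using (HOM.one (K := K) (t := t))
  | succ n ih =>
    rw [pow_succ]
    have := ih.mul hp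
    convert this using 1; push_cast; ring

theorem LEw.sum {ι : Type*} (u : Finset ι) (f : ι → MvPolynomial (Fin 2) K)
    (h : ∀ i ∈ u, LEw t (f i) r) : LEw t (∑ i ∈ u, f i) r := by
  classical
  induction u using Finset.induction_on with
  | empty => simpa using LEw.zero
  | insert a u ha ih =>
    rw [Finset.sum_insert ha]
    exact (h a (by simp)).add (ih fun i hi => h i (by simp [hi]))
theorem LTw.sum {ι : Type*} (u : Finset ι) (f : ι → MvPolynomial (Fin 2) K)
    (h : ∀ i ∈ u, LTw t (f i) r) : LTw t (∑ i ∈ u, f i) r := by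
  classical
  induction u using Finset.induction_on with
  | empty => simpa using LTw.zero
  | insert a u ha ih =>
    rw [Finset.sum_insert ha]
    exact (h a (by simp)).add (ih fun i hi => h i (by simp [hi]))

theorem coeff_pderiv_ne {d} {i : Fin 2} (h : coeff d (pderiv i p) ≠ 0) :
    coeff (d + Finsupp.single i 1) p ≠ 0 := by
  rw [coeff_pderiv] at h
  intro h'; apply h; simp [h']

theorem LEw.pderiv0 (hp : LEw t p r) : LEw t (pderiv 0 p) (r - t) := fun d hd => by
  have := hp _ (coeff_pderiv_ne hd); rw [wt_add, wt_single0] at this; push_cast at this; linarith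
theorem LEw.pderiv1 (hp : LEw t p r) : LEw t (pderiv 1 p) (r - 1) := fun d hd => by
  have := hp _ (coeff_pderiv_ne hd); rw [wt_add, wt_single1] at this; push_cast at this; linarith
theorem LTw.pderiv0 (hp : LTw t p r) : LTw t (pderiv 0 p) (r - t) := fun d hd => by
  have := hp _ (coeff_pderiv_ne hd); rw [wt_add, wt_single0] at this; push_cast at this; linarith
theorem LTw.pderiv1 (hp : LTw t p r) : LTw t (pderiv 1 p) (r - 1) := fun d hd => by
  have := hp _ (coeff_pderiv_ne hd); rw [wt_add, wt_single1] at this; push_cast at this; linarith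
theorem HOM.pderiv0 (hp : HOM t p r) : HOM t (pderiv 0 p) (r - t) := fun d hd => by
  have := hp _ (coeff_pderiv_ne hd); rw [wt_add, wt_single0] at this; push_cast at this; linarith
theorem HOM.pderiv1 (hp : HOM t p r) : HOM t (pderiv 1 p) (r - 1) := fun d hd => by
  have := hp _ (coeff_pderiv_ne hd); rw [wt_add, wt_single1] at this; push_cast at this; linarith

theorem LEw.jac (hp : LEw t p r) (hq : LEw t q s) : LEw t (Jac p q) (r + s - t - 1) :=
  ((hp.pderiv0.mul hq.pderiv1).mono (by linarith)).sub
    ((hp.pderiv1.mul hq.pderiv0).mono (by linarith))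
theorem LTw.jac (hp : LTw t p r) (hq : LEw t q s) : LTw t (Jac p q) (r + s - t - 1) :=
  ((hp.pderiv0.mul_le hq.pderiv1).mono (by linarith)).sub
    ((hp.pderiv1.mul_le hq.pderiv0).mono (by linarith))
theorem LEw.jac_lt (hp : LEw t p r) (hq : LTw t q s) : LTw t (Jac p q) (r + s - t - 1) :=
  ((hp.pderiv0.mul_lt hq.pderiv1).mono (by linarith)).sub
    ((hp.pderiv1.mul_lt hq.pderiv0).mono (by linarith))
theorem HOM.jac (hp : HOM t p r) (hq : HOM t q s) : HOM t (Jac p q) (r + s - t - 1) := by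
  have h1 := hp.pderiv0.mul hq.pderiv1
  have h2 := hp.pderiv1.mul hq.pderiv0
  have e1 : r - t + (s - 1) = r + s - t - 1 := by ring
  have e2 : r - 1 + (s - t) = r + s - t - 1 := by ring
  rw [e1] at h1; rw [e2] at h2
  exact h1.sub h2

/-! ### The degree function -/

/-- Weighted degree with respect to the weights `(t, 1)` (zero polynomial: degree zero). -/
noncomputable def dg (t : ℝ) (p : MvPolynomial (Fin 2) K) : ℝ :=
  if h : p.support.Nonempty then p.support.sup' h (wt t) else 0

theorem dg_continuous (p : MvPolynomial (Fin 2) K) : Continuous fun t => dg t p := by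
  unfold dg
  by_cases h : p.support.Nonempty
  · simp only [h, dif_pos]
    apply Continuous.finset_sup'_apply
    intro i _
    unfold wt; fun_prop
  · simp only [h, dif_neg, not_false_eq_true]
    exact continuous_const

theorem le_dg {d} (hd : coeff d p ≠ 0) : wt t d ≤ dg t p := by
  have hm : d ∈ p.support := mem_support_iff.2 hd
  have h : p.support.Nonempty := ⟨d, hm⟩
  unfold dg; rw [dif_pos h]; exact Finset.le_sup' (wt t) hm

theorem LEw_dg (t : ℝ) (p : MvPolynomial (Fin 2) K) : LEw t p (dg t p) := fun _ hd => le_dg hd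

theorem exists_dg (t : ℝ) (hp : p ≠ 0) : ∃ d, coeff d p ≠ 0 ∧ dg t p = wt t d := by
  have h : p.support.Nonempty := Finset.nonempty_iff_ne_empty.2 (by simpa using hp)
  obtain ⟨d, hd, he⟩ := Finset.exists_mem_eq_sup' h (wt t)
  refine ⟨d, mem_support_iff.1 hd, ?_⟩
  unfold dg; rw [dif_pos h]; exact he

theorem dg_le (hp : p ≠ 0) (h : LEw t p r) : dg t p ≤ r := by
  obtain ⟨d, hd, he⟩ := exists_dg t hp
  rw [he]; exact h d hd

theorem dg_lt (hp : p ≠ 0) (h : LTw t p r) : dg t p < r := by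
  obtain ⟨d, hd, he⟩ := exists_dg t hp
  rw [he]; exact h d hd

theorem dg_eq {d} (hd : coeff d p ≠ 0) (h : LEw t p (wt t d)) : dg t p = wt t d :=
  le_antisymm (dg_le (by rintro rfl; simp at hd) h) (le_dg hd)

theorem dg_congr_support {L : Type*} [Field L] {p' : MvPolynomial (Fin 2) L}
    (h : p.support = p'.support) : dg t p = dg t p' := by
  unfold dg
  simp only [h]

theorem LEw.eq_zero (h : LEw t p r) (ht : 0 < t) (hr : r < 0) : p = 0 := by
  by_contra hp
  obtain ⟨d, hd, -⟩ := exists_dg t hp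
  have := h d hd
  linarith [wt_nonneg ht d]

theorem LEw.eq_C (h : LEw t p 0) (ht : 0 < t) : ∃ c, p = C c := by
  refine ⟨coeff 0 p, ?_⟩
  ext d
  by_cases hd : d = 0
  · subst hd; simp
  · rw [coeff_C, if_neg (Ne.symm hd)]
    by_contra hh
    linarith [h d hh, wt_pos ht hd]

/-! ### Vertices -/

/-- `d` is the extremal monomial of `p`, ties broken by the sign of `s`. -/
def Vert (t s : ℝ) (p : MvPolynomial (Fin 2) K) (d : Fin 2 →₀ ℕ) : Prop :=
  coeff d p ≠ 0 ∧ ∀ e, coeff e p ≠ 0 →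
    wt t e < wt t d ∨ (wt t e = wt t d ∧ s * (e 0 : ℝ) ≤ s * (d 0 : ℝ))

theorem Vert.dg_eq {s : ℝ} {d} (h : Vert t s p d) : dg t p = wt t d :=
  _root_.dg_eq h.1 fun e he => by rcases h.2 e he with h | h; exacts [h.le, h.1.le]

theorem exists_vert (t s : ℝ) (hp : p ≠ 0) : ∃ d, Vert t s p d := by
  classical
  obtain ⟨d0, hd0, he0⟩ := exists_dg t hp
  let S := p.support.filter fun d => wt t d = dg t p
  have hS : S.Nonempty := ⟨d0, by simp [S, hd0, he0]⟩
  obtain ⟨d, hd, hmax⟩ := Finset.exists_max_image S (fun d => s * (d 0 : ℝ)) hS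
  simp only [S, Finset.mem_filter, mem_support_iff] at hd hmax
  refine ⟨d, hd.1, fun e he => ?_⟩
  rcases (le_dg he : wt t e ≤ dg t p).lt_or_eq with h | h
  · left; rwa [hd.2]
  · right; exact ⟨by rw [h, hd.2], hmax e ⟨he, h⟩⟩

/-- Key coefficient computation. -/
theorem coeff_mul_vert {s : ℝ} (hs : s ≠ 0) {d d'} (hd : Vert t s p d) (hd' : Vert t s q d')
    {f g : MvPolynomial (Fin 2) K} (hf : ∀ e, coeff e f ≠ 0 → coeff e p ≠ 0)
    (hg : ∀ e, coeff e g ≠ 0 → coeff e q ≠ 0) :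
    coeff (d + d') (f * g) = coeff d f * coeff d' g := by
  classical
  rw [coeff_mul]
  rw [Finset.sum_eq_single (d, d')]
  · rintro ⟨e, e'⟩ hm hne
    by_contra hh
    replace hm : e + e' = d + d' := Finset.HasAntidiagonal.mem_antidiagonal.1 hm
    have h1 := hd.2 e (hf e (left_ne_zero_of_mul hh))
    have h2 := hd'.2 e' (hg e' (right_ne_zero_of_mul hh))
    have hw : wt t e + wt t e' = wt t d + wt t d' := by rw [← wt_add, ← wt_add, hm]
    have h0 : e 0 + e' 0 = d 0 + d' 0 := by
      have := DFunLike.congr_fun hm 0; simpa using this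
    have h0' : (e 0 : ℝ) + e' 0 = d 0 + d' 0 := by exact_mod_cast h0
    have k1 : wt t e = wt t d := by
      rcases h1 with h1 | h1 <;> rcases h2 with h2 | h2 <;> linarith [h1, h2] 
    have k2 : wt t e' = wt t d' := by linarith
    have l1 : s * (e 0 : ℝ) ≤ s * d 0 := by rcases h1 with h1 | h1; exacts [by linarith, h1.2]
    have l2 : s * (e' 0 : ℝ) ≤ s * d' 0 := by rcases h2 with h2 | h2; exacts [by linarith, h2.2]
    have l3 : s * ((e 0 : ℝ) - d 0) = 0 := by
      have : s * ((e 0 : ℝ) + e' 0) = s * (d 0 + d' 0) := by rw [h0']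
      nlinarith
    have l4 : (e 0 : ℝ) = d 0 := by
      rcases mul_eq_zero.1 l3 with h | h
      · exact absurd h hs
      · linarith
    have l5 : (e 1 : ℝ) = d 1 := by
      unfold wt at k1; rw [l4] at k1; linarith
    have he : e = d := fin2_ext (by exact_mod_cast l4) (by exact_mod_cast l5)
    subst he
    exact hne (by rw [add_left_cancel hm])
  · intro h; exact absurd (by simp) h

theorem Vert.mul {s : ℝ} (hs : s ≠ 0) {d d'} (hd : Vert t s p d) (hd' : Vert t s q d') :
    Vert t s (p * q) (d + d') := by
  refine ⟨?_, fun e he => ?_⟩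
  · rw [coeff_mul_vert hs hd hd' (fun _ h => h) (fun _ h => h)]
    exact mul_ne_zero hd.1 hd'.1
  · obtain ⟨f, g, rfl, hf, hg⟩ := coeff_mul_ne he
    have h1 := hd.2 f hf
    have h2 := hd'.2 g hg
    simp only [wt_add, Finsupp.add_apply, Nat.cast_add, mul_add]
    rcases h1 with h1 | h1 <;> rcases h2 with h2 | h2
    · left; linarith
    · left; linarith
    · left; linarith
    · right; exact ⟨by linarith, by linarith⟩

theorem dg_mul (t : ℝ) (hp : p ≠ 0) (hq : q ≠ 0) : dg t (p * q) = dg t p + dg t q := by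
  obtain ⟨d, hd⟩ := exists_vert t 1 hp
  obtain ⟨d', hd'⟩ := exists_vert t 1 hq
  rw [(hd.mul one_ne_zero hd').dg_eq, hd.dg_eq, hd'.dg_eq, wt_add]

theorem Vert.one {s : ℝ} : Vert t s (1 : MvPolynomial (Fin 2) K) 0 := by
  classical
  refine ⟨by simp, fun e he => ?_⟩
  rw [coeff_one] at he
  by_cases h : 0 = e
  · subst h; right; simp
  · simp [h] at he

theorem Vert.pow {s : ℝ} (hs : s ≠ 0) {d} (hd : Vert t s p d) (n : ℕ) :
    Vert t s (p ^ n) (n • d) := by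
  induction n with
  | zero => simpa using Vert.one
  | succ n ih => rw [pow_succ, succ_nsmul]; exact ih.mul hs hd

theorem dg_pow (t : ℝ) (hp : p ≠ 0) (n : ℕ) : dg t (p ^ n) = n * dg t p := by
  obtain ⟨d, hd⟩ := exists_vert t 1 hp
  rw [(hd.pow one_ne_zero n).dg_eq, hd.dg_eq, wt_nsmul]

theorem dg_C (t : ℝ) (c : K) : dg t (C c : MvPolynomial (Fin 2) K) = 0 := by
  by_cases hc : c = 0
  · subst hc; simp [dg]
  · rw [dg_eq (d := 0) (by simpa using hc), wt_zero]
    rw [wt_zero]; exact (HOM.C c).le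

theorem dg_C_mul (t : ℝ) {c : K} (hc : c ≠ 0) (hp : p ≠ 0) : dg t (C c * p) = dg t p := by
  rw [dg_mul t (by simpa using hc) hp, dg_C, zero_add]

theorem ne_zero_of_dg_pos (h : 0 < dg t p) : p ≠ 0 := by
  rintro rfl; simp [dg] at h

/-- Adding lower order terms does not change the degree. -/
theorem dg_add_lt (hp : p ≠ 0) (hq : LTw t q (dg t p)) : dg t (p + q) = dg t p := by
  obtain ⟨d, hd, he⟩ := exists_dg t hp
  have hqd : coeff d q = 0 := by
    by_contra h
    exact absurd (hq d h) (by rw [he]; exact lt_irrefl _)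
  rw [he]
  apply dg_eq
  · simpa [hqd] using hd
  · rw [← he]; exact (LEw_dg t p).add hq.le

theorem add_ne_zero_of_lt (hp : p ≠ 0) (hq : LTw t q (dg t p)) : p + q ≠ 0 := by
  obtain ⟨d, hd, he⟩ := exists_dg t hp
  have hqd : coeff d q = 0 := by
    by_contra h
    exact absurd (hq d h) (by rw [he]; exact lt_irrefl _)
  intro h
  have := congrArg (coeff d) h
  simp [hqd] at this
  exact hd this

end basics


/-! ### Chain rule, injectivity, vertex lemma -/
section chain
variable {K : Type*} [Field K]

theorem deriv_hom (f : MvPolynomial (Fin 2) K →ₐ[K] MvPolynomial (Fin 2) K)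
    (D : Derivation K (MvPolynomial (Fin 2) K) (MvPolynomial (Fin 2) K))
    (p : MvPolynomial (Fin 2) K) :
    D (f p) = f (pderiv 0 p) * D (f (X 0)) + f (pderiv 1 p) * D (f (X 1)) := by
  induction p using MvPolynomial.induction_on with
  | C a =>
    have : f (C a) = algebraMap K _ a := f.commutes a
    rw [this]; simp
  | add p q hp hq => simp only [map_add, hp, hq]; ring
  | mul_X p i hp =>
    have h00 : pderiv (0 : Fin 2) (X 0 : MvPolynomial (Fin 2) K) = 1 := by simp
    have h01 : pderiv (1 : Fin 2) (X 0 : MvPolynomial (Fin 2) K) = 0 := by simp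
    have h10 : pderiv (0 : Fin 2) (X 1 : MvPolynomial (Fin 2) K) = 0 := by simp
    have h11 : pderiv (1 : Fin 2) (X 1 : MvPolynomial (Fin 2) K) = 1 := by simp
    fin_cases i <;> simp only [map_mul, Derivation.leibniz, hp, smul_eq_mul, map_add,
      Fin.zero_eta, Fin.mk_one, Fin.isValue, h00, h01, h10, h11, map_one, map_zero] <;> ring

/-- `Jac · H` as a derivation. -/
noncomputable def jacD (H : MvPolynomial (Fin 2) K) :
    Derivation K (MvPolynomial (Fin 2) K) (MvPolynomial (Fin 2) K) :=
  (pderiv 1 H) • pderiv 0 - (pderiv 0 H) • pderiv 1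

theorem jacD_apply (H p : MvPolynomial (Fin 2) K) : jacD H p = Jac p H := by
  simp [jacD, Jac]; ring

theorem jac_swap (p q : MvPolynomial (Fin 2) K) : Jac p q = - Jac q p := by
  simp [Jac]; ring

theorem jac_self (p : MvPolynomial (Fin 2) K) : Jac p p = 0 := by
  simp [Jac]; ring

theorem jac_add_left (p q r : MvPolynomial (Fin 2) K) : Jac (p + q) r = Jac p r + Jac q r := by
  simp only [Jac, map_add]; ring
theorem jac_add_right (p q r : MvPolynomial (Fin 2) K) : Jac r (p + q) = Jac r p + Jac r q := by
  simp only [Jac, map_add]; ring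
theorem jac_sub_left (p q r : MvPolynomial (Fin 2) K) : Jac (p - q) r = Jac p r - Jac q r := by
  simp only [Jac, map_sub]; ring
theorem jac_sub_right (p q r : MvPolynomial (Fin 2) K) : Jac r (p - q) = Jac r p - Jac r q := by
  simp only [Jac, map_sub]; ring
theorem jac_C_left (c : K) (r : MvPolynomial (Fin 2) K) : Jac (C c) r = 0 := by
  simp [Jac]
theorem jac_C_right (c : K) (r : MvPolynomial (Fin 2) K) : Jac r (C c) = 0 := by
  simp [Jac]
theorem jac_C_mul_left (c : K) (p r : MvPolynomial (Fin 2) K) :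
    Jac (C c * p) r = C c * Jac p r := by
  simp only [Jac, pderiv_C_mul]; ring
theorem jac_C_mul_right (c : K) (p r : MvPolynomial (Fin 2) K) :
    Jac r (C c * p) = C c * Jac r p := by
  simp only [Jac, pderiv_C_mul]; ring
theorem jac_X : Jac (X 0 : MvPolynomial (Fin 2) K) (X 1) = 1 := by
  simp [Jac]

theorem jac_hom_left (f : MvPolynomial (Fin 2) K →ₐ[K] MvPolynomial (Fin 2) K)
    (p g : MvPolynomial (Fin 2) K) :
    Jac (f p) g = f (pderiv 0 p) * Jac (f (X 0)) g + f (pderiv 1 p) * Jac (f (X 1)) g := by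
  simp only [← jacD_apply]; exact deriv_hom f _ p

theorem jac_hom (f : MvPolynomial (Fin 2) K →ₐ[K] MvPolynomial (Fin 2) K)
    (p q : MvPolynomial (Fin 2) K) :
    Jac (f p) (f q) = f (Jac p q) * Jac (f (X 0)) (f (X 1)) := by
  have e0 := deriv_hom f (pderiv 0) 
  have e1 := deriv_hom f (pderiv 1)
  simp only [Jac, map_sub, map_mul]
  rw [e0 p, e0 q, e1 p, e1 q]; ring

theorem const_of_pderiv [CharZero K] {p : MvPolynomial (Fin 2) K} (h0 : pderiv 0 p = 0)
    (h1 : pderiv 1 p = 0) : ∃ c, p = C c := by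
  have key : ∀ i : Fin 2, pderiv i p = 0 := by intro i; fin_cases i; exacts [h0, h1]
  refine LEw.eq_C (t := 1) (fun d hd => ?_) one_pos
  have hz : ∀ i : Fin 2, d i = 0 := by
    intro i
    by_contra hi
    have := congrArg (coeff (d - Finsupp.single i 1)) (key i)
    rw [coeff_pderiv, tsub_add_cancel_of_le, coeff_zero] at this
    · rcases mul_eq_zero.1 this with h | h
      · exact hd h
      · exact Nat.cast_add_one_ne_zero _ h
    · rw [Finsupp.single_le_iff]; omega
  simp [wt, hz]

theorem inj_aux [CharZero K] (f : MvPolynomial (Fin 2) K →ₐ[K] MvPolynomial (Fin 2) K) {c : K}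
    (hc : c ≠ 0) (h : Jac (f (X 0)) (f (X 1)) = C c) (n : ℕ) :
    ∀ p, LEw 1 p n → f p = 0 → p = 0 := by
  induction n with
  | zero =>
    intro p hp hf
    obtain ⟨a, rfl⟩ := LEw.eq_C (by simpa using hp) one_pos
    have : f (C a) = C a := f.commutes a
    rw [← this, hf]
  | succ n ih =>
    intro p hp hf
    have e0 := deriv_hom f (pderiv 0) p
    have e1 := deriv_hom f (pderiv 1) p
    rw [hf, map_zero] at e0 e1
    have hCc : (C c : MvPolynomial (Fin 2) K) ≠ 0 := by simpa using hc
    rw [Jac] at h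
    have k0 : f (pderiv 0 p) * C c = 0 := by
      rw [← h]; linear_combination (-pderiv 1 (f (X 1))) * e0 + pderiv 0 (f (X 1)) * e1
    have k1 : f (pderiv 1 p) * C c = 0 := by
      rw [← h]; linear_combination (pderiv 1 (f (X 0))) * e0 - pderiv 0 (f (X 0)) * e1
    have l0 := ih _ ((hp.pderiv0).mono (by push_cast; linarith))
      ((mul_eq_zero.1 k0).resolve_right hCc)
    have l1 := ih _ ((hp.pderiv1).mono (by push_cast; linarith))
      ((mul_eq_zero.1 k1).resolve_right hCc)
    obtain ⟨a, rfl⟩ := const_of_pderiv l0 l1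
    have : f (C a) = C a := f.commutes a
    rw [← this, hf]

theorem jac_injective [CharZero K] (f : MvPolynomial (Fin 2) K →ₐ[K] MvPolynomial (Fin 2) K)
    {c : K} (hc : c ≠ 0) (h : Jac (f (X 0)) (f (X 1)) = C c) : Function.Injective f := by
  rw [injective_iff_map_eq_zero]
  intro p hp
  obtain ⟨n, hn⟩ := exists_nat_ge (dg 1 p)
  exact inj_aux f hc h n p ((LEw_dg 1 p).mono hn) hp

theorem jac_equiv (σ : MvPolynomial (Fin 2) K ≃ₐ[K] MvPolynomial (Fin 2) K) :
    ∃ c : K, c ≠ 0 ∧ Jac (σ (X 0)) (σ (X 1)) = C c := by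
  have h : Jac (σ (σ.symm (X 0))) (σ (σ.symm (X 1))) =
      σ (Jac (σ.symm (X 0)) (σ.symm (X 1))) * Jac (σ (X 0)) (σ (X 1)) :=
    jac_hom σ.toAlgHom (σ.symm (X 0)) (σ.symm (X 1))
  simp only [AlgEquiv.apply_symm_apply, jac_X] at h
  have hu : IsUnit (Jac (σ (X 0)) (σ (X 1))) := IsUnit.of_mul_eq_one_right _ h.symm
  obtain ⟨c, hc, he⟩ := (MvPolynomial.isUnit_iff_eq_C_of_isReduced).1 hu
  exact ⟨c, hc.ne_zero, he⟩

theorem coeff_theta (i : Fin 2) (d : Fin 2 →₀ ℕ) (p : MvPolynomial (Fin 2) K) :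
    coeff d (X i * pderiv i p) = (d i : K) * coeff d p := by
  classical
  rw [coeff_X_mul']
  split_ifs with h
  · have h' : d i ≠ 0 := by simpa using h
    rw [coeff_pderiv, tsub_add_cancel_of_le (by rw [Finsupp.single_le_iff]; omega)]
    have : (d - Finsupp.single i 1 : Fin 2 →₀ ℕ) i + 1 = d i := by
      simp; omega
    rw [← Nat.cast_add_one, this, mul_comm]
  · have h' : d i = 0 := by simpa using h
    simp [h']

theorem coeff_jac_vert {t s : ℝ} (hs : s ≠ 0) {p q : MvPolynomial (Fin 2) K} {d d'}
    (hd : Vert t s p d) (hd' : Vert t s q d') :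
    coeff (d + d') (X 0 * X 1 * Jac p q) =
      ((d 0 : K) * d' 1 - d 1 * d' 0) * (coeff d p * coeff d' q) := by
  have e : X 0 * X 1 * Jac p q = (X 0 * pderiv 0 p) * (X 1 * pderiv 1 q) -
      (X 1 * pderiv 1 p) * (X 0 * pderiv 0 q) := by rw [Jac]; ring
  rw [e, coeff_sub, coeff_mul_vert hs hd hd' (f := X 0 * pderiv 0 p),
    coeff_mul_vert hs hd hd' (f := X 1 * pderiv 1 p)]
  · simp only [coeff_theta]; ring
  all_goals
    intro e he
    rw [coeff_theta] at he
    exact right_ne_zero_of_mul he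

theorem vert_prop [CharZero K] {t s : ℝ} (hs : s ≠ 0) {p q : MvPolynomial (Fin 2) K} {d d'}
    (hd : Vert t s p d) (hd' : Vert t s q d') {c : K} (h : Jac p q = C c)
    (hw : wt t d + wt t d' ≠ t + 1) : d 0 * d' 1 = d 1 * d' 0 := by
  have h1 := coeff_jac_vert hs hd hd'
  have h2 : coeff (d + d') (X 0 * X 1 * Jac p q) = 0 := by
    by_contra hne
    have hh : HOM t (X 0 * X 1 * Jac p q) (t + 1 + 0) := by
      rw [h]; exact (HOM.X0.mul HOM.X1).mul (HOM.C c)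
    have := hh _ hne
    rw [wt_add] at this
    exact hw (by linarith)
  rw [h2] at h1
  have h3 := (mul_eq_zero.1 h1.symm).resolve_right (mul_ne_zero hd.1 hd'.1)
  exact_mod_cast sub_eq_zero.1 h3

end chain


/-! ### Propagation of the proportionality of degrees -/
section slemma
variable {K : Type*} [Field K]
open Filter Topology

/-- Degrees of `p` and `q` are proportional to `a : b`, and large enough. -/
def Pi' (a b : ℕ) (t : ℝ) (p q : MvPolynomial (Fin 2) K) : Prop :=
  (b : ℝ) * dg t p = a * dg t q ∧ t + 1 < dg t p + dg t q

theorem Pi'.pos {a b : ℕ} {t : ℝ} {p q : MvPolynomial (Fin 2) K} (ha : 0 < a) (hb : 0 < b)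
    (ht : 0 < t) (h : Pi' a b t p q) : 0 < dg t p ∧ 0 < dg t q := by
  obtain ⟨h1, h2⟩ := h
  have ha' : (0 : ℝ) < a := by exact_mod_cast ha
  have hb' : (0 : ℝ) < b := by exact_mod_cast hb
  constructor
  · by_contra hh
    push Not at hh
    have : (b : ℝ) * dg t p ≤ 0 := mul_nonpos_of_nonneg_of_nonpos hb'.le hh
    have : dg t q ≤ 0 := by
      by_contra h3; push Not at h3; have := mul_pos ha' h3; linarith
    linarith
  · by_contra hh
    push Not at hh
    have : (a : ℝ) * dg t q ≤ 0 := mul_nonpos_of_nonneg_of_nonpos ha'.le hh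
    have : dg t p ≤ 0 := by
      by_contra h3; push Not at h3; have := mul_pos hb' h3; linarith
    linarith

theorem vert_ratio [CharZero K] {a b : ℕ} (ha : 0 < a) (hb : 0 < b) {t s : ℝ} (ht : 0 < t)
    (hs : s ≠ 0) {p q : MvPolynomial (Fin 2) K} {c : K} (hJ : Jac p q = C c)
    (h : Pi' a b t p q) {d d'} (hd : Vert t s p d) (hd' : Vert t s q d') :
    b * d 0 = a * d' 0 ∧ b * d 1 = a * d' 1 := by
  have hp := h.pos ha hb ht
  obtain ⟨h1, h2⟩ := h
  rw [hd.dg_eq, hd'.dg_eq] at h1 h2 hp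
  have hv := vert_prop hs hd hd' hJ (by linarith)
  have hv' : (d 0 : ℝ) * d' 1 = d 1 * d' 0 := by exact_mod_cast hv
  have hw' := hp.2.ne'
  have e0 : (b : ℝ) * d 0 = a * d' 0 := by
    apply mul_right_cancel₀ hw'
    have : (a : ℝ) * d' 0 * wt t d' = (b * wt t d) * d' 0 := by rw [h1]; ring
    rw [this]; unfold wt; linear_combination (b : ℝ) * hv'
  have e1 : (b : ℝ) * d 1 = a * d' 1 := by
    apply mul_right_cancel₀ hw'
    have : (a : ℝ) * d' 1 * wt t d' = (b * wt t d) * d' 1 := by rw [h1]; ring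
    rw [this]; unfold wt; linear_combination -(b : ℝ) * t * hv'
  exact ⟨by exact_mod_cast e0, by exact_mod_cast e1⟩

theorem wt_continuous (d : Fin 2 →₀ ℕ) : Continuous fun t => wt t d := by
  unfold wt; fun_prop

theorem vert_right {t : ℝ} {p : MvPolynomial (Fin 2) K} {d} (hd : Vert t 1 p d) :
    ∀ᶠ t' in 𝓝[≥] t, dg t' p = wt t' d := by
  have : ∀ᶠ t' in 𝓝[≥] t, ∀ e ∈ p.support, wt t' e ≤ wt t' d := by
    rw [Finset.eventually_all]
    intro e he
    rcases hd.2 e (mem_support_iff.1 he) with h | ⟨h1, h2⟩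
    · exact nhdsWithin_le_nhds <| ((wt_continuous e).continuousAt.eventually_lt
        (wt_continuous d).continuousAt h).mono fun _ h => h.le
    · filter_upwards [self_mem_nhdsWithin] with x hx
      have hx' : t ≤ x := hx
      unfold wt at *
      nlinarith
  filter_upwards [this] with x hx
  exact dg_eq hd.1 fun e he => hx e (mem_support_iff.2 he)

theorem vert_left {t : ℝ} {p : MvPolynomial (Fin 2) K} {d} (hd : Vert t (-1) p d) :
    ∀ᶠ t' in 𝓝[≤] t, dg t' p = wt t' d := by
  have : ∀ᶠ t' in 𝓝[≤] t, ∀ e ∈ p.support, wt t' e ≤ wt t' d := by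
    rw [Finset.eventually_all]
    intro e he
    rcases hd.2 e (mem_support_iff.1 he) with h | ⟨h1, h2⟩
    · exact nhdsWithin_le_nhds <| ((wt_continuous e).continuousAt.eventually_lt
        (wt_continuous d).continuousAt h).mono fun _ h => h.le
    · filter_upwards [self_mem_nhdsWithin] with x hx
      have hx' : x ≤ t := hx
      unfold wt at *
      nlinarith
  filter_upwards [this] with x hx
  exact dg_eq hd.1 fun e he => hx e (mem_support_iff.2 he)

theorem Pi'.eventually [CharZero K] {a b : ℕ} (ha : 0 < a) (hb : 0 < b) {t : ℝ} (ht : 0 < t)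
    {p q : MvPolynomial (Fin 2) K} {c : K} (hJ : Jac p q = C c)
    (h : Pi' a b t p q) : ∀ᶠ t' in 𝓝 t, Pi' a b t' p q := by
  have hp := h.pos ha hb ht
  have h2 : ∀ᶠ t' in 𝓝 t, t' + 1 < dg t' p + dg t' q :=
    ContinuousAt.eventually_lt (by fun_prop)
      ((dg_continuous p).add (dg_continuous q)).continuousAt h.2
  have key : ∀ d d' : Fin 2 →₀ ℕ, (b * d 0 = a * d' 0 ∧ b * d 1 = a * d' 1) → ∀ x,
      (b : ℝ) * wt x d = a * wt x d' := by
    rintro d d' ⟨h0, h1⟩ x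
    have h0' : (b : ℝ) * d 0 = a * d' 0 := by exact_mod_cast h0
    have h1' : (b : ℝ) * d 1 = a * d' 1 := by exact_mod_cast h1
    unfold wt; linear_combination x * h0' + h1'
  have h1 : ∀ᶠ t' in 𝓝 t, (b : ℝ) * dg t' p = a * dg t' q := by
    rw [← nhdsLE_sup_nhdsGE, eventually_sup]
    constructor
    · obtain ⟨d, hd⟩ := exists_vert t (-1) (ne_zero_of_dg_pos hp.1)
      obtain ⟨d', hd'⟩ := exists_vert t (-1) (ne_zero_of_dg_pos hp.2)
      have hr := vert_ratio ha hb ht (by norm_num) hJ h hd hd'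
      filter_upwards [vert_left hd, vert_left hd'] with x hx hx'
      rw [hx, hx', key d d' hr]
    · obtain ⟨d, hd⟩ := exists_vert t 1 (ne_zero_of_dg_pos hp.1)
      obtain ⟨d', hd'⟩ := exists_vert t 1 (ne_zero_of_dg_pos hp.2)
      have hr := vert_ratio ha hb ht (by norm_num) hJ h hd hd'
      filter_upwards [vert_right hd, vert_right hd'] with x hx hx'
      rw [hx, hx', key d d' hr]
  exact h1.and h2

theorem linear_part {p q : MvPolynomial (Fin 2) K} {c : K} (hc : c ≠ 0) (hJ : Jac p q = C c)
    (i : Fin 2) : coeff (Finsupp.single i 1) p ≠ 0 ∨ coeff (Finsupp.single i 1) q ≠ 0 := by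
  by_contra hh
  push Not at hh
  have h := congrArg constantCoeff hJ
  simp only [Jac, map_sub, map_mul, constantCoeff_C] at h
  simp only [constantCoeff_eq, coeff_pderiv, zero_add] at h
  apply hc
  rw [← h]
  fin_cases i <;> simp_all

theorem Pi'.strong [CharZero K] {a b : ℕ} (ha : 2 ≤ a) (hab : a < b) (hco : a.Coprime b) {t : ℝ}
    (ht : 0 < t) {p q : MvPolynomial (Fin 2) K} {c : K} (hc : c ≠ 0) (hJ : Jac p q = C c)
    (h : Pi' a b t p q) : ((a : ℝ) + b) * (t + 1) ≤ (b + 1) * (dg t p + dg t q) := by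
  have hp := h.pos (by omega) (by omega) ht
  obtain ⟨d, hd⟩ := exists_vert t 1 (ne_zero_of_dg_pos hp.1)
  obtain ⟨d', hd'⟩ := exists_vert t 1 (ne_zero_of_dg_pos hp.2)
  obtain ⟨h0, h1⟩ := vert_ratio (by omega) (by omega) ht (by norm_num) hJ h hd hd'
  obtain ⟨u, hu⟩ : a ∣ d 0 := hco.dvd_of_dvd_mul_left ⟨_, h0⟩
  obtain ⟨v, hv⟩ : a ∣ d 1 := hco.dvd_of_dvd_mul_left ⟨_, h1⟩
  have ha' : (2 : ℝ) ≤ a := by exact_mod_cast ha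
  have hab' : (a : ℝ) < b := by exact_mod_cast hab
  have hD : dg t p = a * (t * u + v) := by
    rw [hd.dg_eq, wt, hu, hv]; push_cast; ring
  have hD' : dg t q = b * (t * u + v) := by
    have := h.1
    rw [hD] at this
    apply mul_left_cancel₀ (show (a : ℝ) ≠ 0 by linarith)
    rw [← this]; ring
  set D := t * u + v with hDdef
  have hDpos : 0 < D := by
    have := hp.1; rw [hD] at this
    exact (pos_iff_pos_of_mul_pos this).1 (by linarith)
  have hlin : ∀ i : Fin 2, wt t (Finsupp.single i 1) ≤ b * D := by
    intro i
    rcases linear_part hc hJ i with h | h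
    · have := le_dg (t := t) h; rw [hD] at this; nlinarith
    · have := le_dg (t := t) h; rwa [hD'] at this
  have l0 := hlin 0
  have l1 := hlin 1
  rw [wt_single0] at l0
  rw [wt_single1] at l1
  have hmain : t + 1 ≤ (b + 1) * D := by
    rcases Nat.eq_zero_or_pos u with hu0 | hu0
    · have hv1 : 1 ≤ v := by
        by_contra hv0
        have : v = 0 := by omega
        simp [hDdef, hu0, this] at hDpos
      have hv1' : (1 : ℝ) ≤ v := by exact_mod_cast hv1
      have : (1 : ℝ) ≤ D := by rw [hDdef, hu0]; simpa using hv1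
      push_cast at l0 l1
      linarith
    · have hu1 : (1 : ℝ) ≤ u := by exact_mod_cast hu0
      have hv1 : (0 : ℝ) ≤ v := by positivity
      have : t ≤ D := by rw [hDdef]; nlinarith
      push_cast at l0 l1
      linarith
  rw [hD, hD']
  have : 0 ≤ (a : ℝ) + b := by linarith
  nlinarith [mul_le_mul_of_nonneg_left hmain this]

theorem slemma [CharZero K] {a b : ℕ} (ha : 2 ≤ a) (hab : a < b) (hco : a.Coprime b)
    {p q : MvPolynomial (Fin 2) K} {c : K} (hc : c ≠ 0) (hJ : Jac p q = C c)
    {t₀ : ℝ} (ht₀ : 0 < t₀) (h₀ : Pi' a b t₀ p q) {t : ℝ} (ht : 0 < t) : Pi' a b t p q := by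
  let u : Set ℝ := {t | 0 < t ∧ Pi' a b t p q}
  have ha' : (2 : ℝ) ≤ a := by exact_mod_cast ha
  have hab' : (a : ℝ) < b := by exact_mod_cast hab
  have hu : IsOpen u := by
    rw [isOpen_iff_mem_nhds]
    rintro x ⟨hx, hP⟩
    exact (lt_mem_nhds hx).and (hP.eventually (by omega) (by omega) hx hJ)
  let F : Set ℝ := {t | (b : ℝ) * dg t p = a * dg t q} ∩
    {t | ((a : ℝ) + b) * (t + 1) ≤ (b + 1) * (dg t p + dg t q)}
  have hcp := dg_continuous p
  have hcq := dg_continuous q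
  have hF : IsClosed F := by
    refine IsClosed.inter (isClosed_eq ?_ ?_) (isClosed_le ?_ ?_)
    · exact continuous_const.mul hcp
    · exact continuous_const.mul hcq
    · fun_prop
    · exact continuous_const.mul (hcp.add hcq)
  have huF : closure u ⊆ F := by
    apply closure_minimal _ hF
    rintro x ⟨hx, hP⟩
    exact ⟨hP.1, hP.strong ha hab hco hx hc hJ⟩
  have hsub : Set.Ioi (0 : ℝ) ⊆ u := by
    apply isPreconnected_Ioi.subset_of_closure_inter_subset hu ⟨t₀, ht₀, ht₀, h₀⟩
    rintro x ⟨hx, hx0⟩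
    have hx0' : 0 < x := hx0
    obtain ⟨h1, h2⟩ := huF hx
    refine ⟨hx0, h1, ?_⟩
    have h2' : ((a : ℝ) + b) * (x + 1) ≤ (b + 1) * (dg x p + dg x q) := h2
    by_contra hh
    push Not at hh
    nlinarith
  exact (hsub ht).2

end slemma


/-! ### Locally nilpotent derivations -/
section lnd
variable {K : Type*} [Field K]
variable (D : Derivation K (MvPolynomial (Fin 2) K) (MvPolynomial (Fin 2) K))

theorem iter_zero (n : ℕ) : D^[n] 0 = 0 := by
  induction n with
  | zero => rfl
  | succ n ih => rw [Function.iterate_succ_apply', ih, map_zero]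

theorem iter_add (n : ℕ) (f g : MvPolynomial (Fin 2) K) :
    D^[n] (f + g) = D^[n] f + D^[n] g := by
  induction n with
  | zero => rfl
  | succ n ih => simp only [Function.iterate_succ_apply', ih, map_add]

theorem iter_of_le {n m : ℕ} (h : n ≤ m) {f : MvPolynomial (Fin 2) K} (hf : D^[n] f = 0) :
    D^[m] f = 0 := by
  obtain ⟨k, rfl⟩ := Nat.exists_eq_add_of_le h
  rw [add_comm, Function.iterate_add_apply, hf, iter_zero]

theorem iter_mul (n : ℕ) : ∀ (i j : ℕ) (f g : MvPolynomial (Fin 2) K), i + j = n →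
    D^[i + 1] f = 0 → D^[j + 1] g = 0 →
    D^[n] (f * g) = (n.choose i : MvPolynomial (Fin 2) K) * (D^[i] f * D^[j] g) := by
  induction n with
  | zero =>
    intro i j f g h hf hg
    obtain ⟨rfl, rfl⟩ : i = 0 ∧ j = 0 := by omega
    simp
  | succ n ih =>
    intro i j f g h hf hg
    rw [Function.iterate_succ_apply, Derivation.leibniz, iter_add]
    simp only [smul_eq_mul]
    rcases i with _ | i
    · rcases j with _ | j
      · omega
      · have hDf : D f = 0 := by simpa using hf
        rw [hDf, mul_zero, iter_zero, ih 0 j f (D g) (by omega) hf hg]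
        simp
    · rcases j with _ | j
      · have hDg : D g = 0 := by simpa using hg
        rw [hDg, mul_zero, iter_zero, mul_comm g, ih i 0 (D f) g (by omega) hf hg]
        obtain rfl : i = n := by omega
        simp
      · rw [mul_comm g, ih i (j + 1) (D f) g (by omega) hf hg,
          ih (i + 1) j f (D g) (by omega) hf hg, Nat.choose_succ_succ]
        simp only [Function.iterate_succ_apply, Nat.cast_add]
        ring

/-- exact nilpotency order -/
def LD (n : ℕ) (f : MvPolynomial (Fin 2) K) : Prop := D^[n] f ≠ 0 ∧ D^[n + 1] f = 0

/-- local nilpotency -/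
def LND : Prop := ∀ f, ∃ n, D^[n] f = 0

variable {D}

theorem LND.exists_LD (h : LND D) {f : MvPolynomial (Fin 2) K} (hf : f ≠ 0) : ∃ n, LD D n f := by
  classical
  have hn := Nat.find_spec (h f)
  rcases hk : Nat.find (h f) with _ | k
  · rw [hk] at hn; exact absurd hn hf
  · exact ⟨k, Nat.find_min (h f) (by omega), by rwa [hk] at hn⟩

theorem LD.unique {n m : ℕ} {f : MvPolynomial (Fin 2) K} (h : LD D n f) (h' : LD D m f) :
    n = m := by
  rcases lt_trichotomy n m with hh | hh | hh
  · exact absurd (iter_of_le D hh h.2) h'.1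
  · exact hh
  · exact absurd (iter_of_le D hh h'.2) h.1

theorem LD.mul [CharZero K] {n m : ℕ} {f g : MvPolynomial (Fin 2) K} (h : LD D n f)
    (h' : LD D m g) : LD D (n + m) (f * g) := by
  have e := iter_mul D (n + m) n m f g rfl h.2 h'.2
  constructor
  · rw [e]
    refine mul_ne_zero ?_ (mul_ne_zero h.1 h'.1)
    have : ((n + m).choose n : K) ≠ 0 := by
      exact_mod_cast (Nat.choose_pos (by omega)).ne'
    rw [← map_natCast (C : K →+* MvPolynomial (Fin 2) K)]
    simpa using this
  · have h1 := h.2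
    have h2 := h'.2
    rw [Function.iterate_succ_apply'] at h1 h2 ⊢
    rw [e]; simp [h1, h2]

theorem LND.ker_of_mul [CharZero K] (h : LND D) {f g : MvPolynomial (Fin 2) K} (hfg : f * g ≠ 0)
    (hD : D (f * g) = 0) : D f = 0 := by
  obtain ⟨n, hn⟩ := h.exists_LD (left_ne_zero_of_mul hfg)
  obtain ⟨m, hm⟩ := h.exists_LD (right_ne_zero_of_mul hfg)
  have h0 : LD D 0 (f * g) := ⟨hfg, hD⟩
  have := (hn.mul hm).unique h0
  obtain rfl : n = 0 := by omega
  exact hn.2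

theorem LD.der {n : ℕ} {f : MvPolynomial (Fin 2) K} (h : LD D n f) (hf : D f ≠ 0) :
    ∃ k, n = k + 1 ∧ LD D k (D f) := by
  rcases n with _ | k
  · exact absurd h.2 hf
  · exact ⟨k, rfl, h⟩

theorem LND.no_cross [CharZero K] (h : LND D) {x y a b : MvPolynomial (Fin 2) K}
    (hx : D x = y * a) (hy : D y = x * b) : D x = 0 ∨ D y = 0 := by
  by_contra hh
  push Not at hh
  obtain ⟨h1, h2⟩ := hh
  have hx0 : x ≠ 0 := by rintro rfl; simp at h1
  have hy0 : y ≠ 0 := by rintro rfl; simp at h2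
  obtain ⟨n, hn⟩ := h.exists_LD hx0
  obtain ⟨m, hm⟩ := h.exists_LD hy0
  obtain ⟨k, hk, hk'⟩ := hn.der h1
  obtain ⟨l, hl, hl'⟩ := hm.der h2
  rw [hx] at h1 hk'
  rw [hy] at h2 hl'
  obtain ⟨u, hu⟩ := h.exists_LD (right_ne_zero_of_mul h1)
  obtain ⟨v, hv⟩ := h.exists_LD (right_ne_zero_of_mul h2)
  have e1 := (hm.mul hu).unique hk'
  have e2 := (hn.mul hv).unique hl'
  omega

/-- Nilpotency can be tested on generators. -/
theorem LND.of_gen (τ : MvPolynomial (Fin 2) K ≃ₐ[K] MvPolynomial (Fin 2) K)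
    (h : ∀ i : Fin 2, ∃ n, D^[n] (τ (X i)) = 0) : LND D := by
  have hmul : ∀ f g, (∃ n, D^[n] f = 0) → (∃ n, D^[n] g = 0) → ∃ n, D^[n] (f * g) = 0 := by
    rintro f g ⟨n, hn⟩ ⟨m, hm⟩
    have hn' := iter_of_le D (Nat.le_succ n) hn
    have hm' := iter_of_le D (Nat.le_succ m) hm
    refine ⟨n + m, ?_⟩
    rw [iter_mul D (n + m) n m f g rfl hn' hm', hn]; simp
  have key : ∀ g, ∃ n, D^[n] (τ g) = 0 := by
    intro g
    induction g using MvPolynomial.induction_on with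
    | C a =>
      refine ⟨1, ?_⟩
      have : τ (C a) = algebraMap K _ a := τ.commutes a
      simp [this]
    | add p q hp hq =>
      obtain ⟨n, hn⟩ := hp
      obtain ⟨m, hm⟩ := hq
      refine ⟨max n m, ?_⟩
      rw [map_add, iter_add, iter_of_le D (le_max_left _ _) hn,
        iter_of_le D (le_max_right _ _) hm, add_zero]
    | mul_X p i hp => rw [map_mul]; exact hmul _ _ hp (h i)
  intro f
  obtain ⟨n, hn⟩ := key (τ.symm f)
  exact ⟨n, by simpa using hn⟩

theorem LND.coord (σ : MvPolynomial (Fin 2) K ≃ₐ[K] MvPolynomial (Fin 2) K) :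
    LND (jacD (σ (X 1))) := by
  refine LND.of_gen σ ?_
  obtain ⟨c, -, hc⟩ := jac_equiv σ
  intro i
  fin_cases i
  · refine ⟨2, ?_⟩
    simp [jacD_apply, hc, jac_C_left]
  · refine ⟨1, ?_⟩
    simp [jacD_apply, jac_self]

/-! ### Leading forms -/

/-- `H` is the leading form of `B` for the weights `(t,1)`. -/
def IsLead (t : ℝ) (B H : MvPolynomial (Fin 2) K) : Prop :=
  HOM t H (dg t B) ∧ LTw t (B - H) (dg t B)

theorem IsLead.coeff_eq {t : ℝ} {B H : MvPolynomial (Fin 2) K} (h : IsLead t B H) {d}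
    (hd : wt t d = dg t B) : coeff d H = coeff d B := by
  by_contra hne
  have : coeff d (B - H) ≠ 0 := by
    rw [coeff_sub]; exact sub_ne_zero.2 (Ne.symm hne)
  exact absurd (h.2 d this) (by rw [hd]; exact lt_irrefl _)

theorem IsLead.ne_zero {t : ℝ} {B H : MvPolynomial (Fin 2) K} (h : IsLead t B H) (hB : B ≠ 0) :
    H ≠ 0 := by
  obtain ⟨d, hd, he⟩ := exists_dg t hB
  have := h.coeff_eq he.symm
  intro h0
  rw [h0, coeff_zero] at this
  exact hd this.symm

theorem exists_lead (t : ℝ) (B : MvPolynomial (Fin 2) K) : ∃ H, IsLead t B H := by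
  classical
  let S := B.support.filter fun d => wt t d = dg t B
  have hc : ∀ d, coeff d (∑ e ∈ S, monomial e (coeff e B)) =
      if wt t d = dg t B then coeff d B else 0 := by
    intro d
    rw [coeff_sum]
    simp only [coeff_monomial]
    rw [Finset.sum_ite_eq']
    simp only [S, Finset.mem_filter, mem_support_iff]
    by_cases h1 : wt t d = dg t B <;> by_cases h2 : coeff d B = 0 <;> simp [h1, h2]
  refine ⟨∑ e ∈ S, monomial e (coeff e B), ?_, ?_⟩
  · intro d hd
    rw [hc] at hd
    by_contra hh
    simp [hh] at hd
  · intro d hd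
    rw [coeff_sub, hc] at hd
    split_ifs at hd with h
    · simp at hd
    · rw [sub_zero] at hd
      exact lt_of_le_of_ne (le_dg hd) h

theorem HOM.eq_zero_of_lt {t r : ℝ} {p : MvPolynomial (Fin 2) K} (h : HOM t p r)
    (h' : LTw t p r) : p = 0 := by
  ext d
  by_contra hd
  exact absurd (h' d hd) (by rw [h d hd]; exact lt_irrefl _)

theorem LND.lead {t : ℝ} {B H : MvPolynomial (Fin 2) K} (hl : IsLead t B H)
    (hB : LND (jacD B)) : LND (jacD H) := by
  have key : ∀ (n : ℕ) (p : MvPolynomial (Fin 2) K) (s : ℝ), HOM t p s →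
      HOM t ((jacD H)^[n] p) (s + n * (dg t B - t - 1)) ∧
      LTw t ((jacD B)^[n] p - (jacD H)^[n] p) (s + n * (dg t B - t - 1)) := by
    intro n p s hp
    induction n with
    | zero => simpa using ⟨hp, LTw.zero⟩
    | succ n ih =>
      obtain ⟨h1, h2⟩ := ih
      simp only [Function.iterate_succ_apply', jacD_apply]
      set u := (jacD H)^[n] p
      set v := (jacD B)^[n] p
      have er : s + ((n + 1 : ℕ) : ℝ) * (dg t B - t - 1) =
        (s + n * (dg t B - t - 1)) + dg t B - t - 1 := by push_cast; ring
      rw [er]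
      refine ⟨h1.jac hl.1, ?_⟩
      have e : Jac v B - Jac u H = Jac (v - u) B + Jac u (B - H) := by
        rw [jac_sub_left, jac_sub_right]; ring
      rw [e]
      exact (h2.jac (LEw_dg t B)).add (h1.le.jac_lt hl.2)
  refine LND.of_gen AlgEquiv.refl ?_
  have fin : ∀ (p : MvPolynomial (Fin 2) K) (s : ℝ), HOM t p s → ∃ n, (jacD H)^[n] p = 0 := by
    intro p s hp
    obtain ⟨n, hn⟩ := hB p
    obtain ⟨h1, h2⟩ := key n p s hp
    rw [hn, zero_sub] at h2
    have := h2.neg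
    rw [neg_neg] at this
    exact ⟨n, h1.eq_zero_of_lt this⟩
  intro i
  fin_cases i
  · exact fin _ _ HOM.X0
  · exact fin _ _ HOM.X1

theorem pderiv_eq_zero_coeff [CharZero K] {i : Fin 2} {p : MvPolynomial (Fin 2) K}
    (h : pderiv i p = 0) {d} (hd : coeff d p ≠ 0) : d i = 0 := by
  have := coeff_theta i d p
  rw [h, mul_zero, coeff_zero] at this
  have := (mul_eq_zero.1 this.symm).resolve_right hd
  exact_mod_cast this

theorem X_dvd_of {i : Fin 2} {p : MvPolynomial (Fin 2) K} (h : ∀ d, coeff d p ≠ 0 → d i ≠ 0) :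
    X i ∣ p := by
  rw [X_dvd_iff_modMonomial_eq_zero]
  ext d
  by_cases hd : Finsupp.single i 1 ≤ d
  · rw [coeff_modMonomial_of_le _ hd, coeff_zero]
  · rw [coeff_modMonomial_of_not_le _ hd, coeff_zero]
    by_contra hh
    apply hd
    rw [Finsupp.single_le_iff]
    have := h d hh
    omega

/-- divisible by `x` implies pure power of `x` -/
theorem LND.pure0 [CharZero K] {H : MvPolynomial (Fin 2) K} (hl : LND (jacD H)) (hH : H ≠ 0)
    (h : ∀ d, coeff d H ≠ 0 → d 0 ≠ 0) : ∀ d, coeff d H ≠ 0 → d 1 = 0 := by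
  obtain ⟨g, hg⟩ := X_dvd_of h
  have h1 : jacD H (X 0 * g) = 0 := by rw [← hg, jacD_apply, jac_self]
  have h2 := hl.ker_of_mul (by rwa [← hg]) h1
  rw [jacD_apply] at h2
  have h3 : pderiv 1 H = 0 := by simpa [Jac] using h2
  exact fun d hd => pderiv_eq_zero_coeff h3 hd

theorem LND.pure1 [CharZero K] {H : MvPolynomial (Fin 2) K} (hl : LND (jacD H)) (hH : H ≠ 0)
    (h : ∀ d, coeff d H ≠ 0 → d 1 ≠ 0) : ∀ d, coeff d H ≠ 0 → d 0 = 0 := by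
  obtain ⟨g, hg⟩ := X_dvd_of h
  have h1 : jacD H (X 1 * g) = 0 := by rw [← hg, jacD_apply, jac_self]
  have h2 := hl.ker_of_mul (by rwa [← hg]) h1
  rw [jacD_apply] at h2
  have h3 : pderiv 0 H = 0 := by simpa [Jac] using h2
  exact fun d hd => pderiv_eq_zero_coeff h3 hd

end lnd


/-! ### Shape of leading forms of coordinates -/
section shape
variable {K : Type*} [Field K]

theorem shape_root [IsAlgClosed K] {H : MvPolynomial (Fin 2) K} {i j : ℕ} (hi : 0 < i)
    (hH : ∀ d, coeff d H ≠ 0 → j * d 0 + i * d 1 = i * j)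
    (hx : coeff (Finsupp.single 0 i) H ≠ 0) (hy : coeff (Finsupp.single 1 j) H ≠ 0) :
    ∃ ξ : K, ξ ≠ 0 ∧ ∑ d ∈ H.support, coeff d H * ξ ^ (d 0) = 0 := by
  classical
  let h : Polynomial K := ∑ d ∈ H.support, Polynomial.monomial (d 0) (coeff d H)
  have hco : ∀ d, coeff d H ≠ 0 → h.coeff (d 0) = coeff d H := by
    intro d hd
    simp only [h, Polynomial.finsetSum_coeff, Polynomial.coeff_monomial]
    rw [Finset.sum_eq_single d]
    · simp
    · intro e he hne
      rw [if_neg]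
      intro h0
      apply hne
      apply fin2_ext h0
      have h1 := hH d hd
      have h2 := hH e (mem_support_iff.1 he)
      rw [h0] at h2
      exact Nat.eq_of_mul_eq_mul_left hi (by omega)
    · intro hh; exact absurd (mem_support_iff.2 hd) hh
  have c0 := hco _ hy
  have ci := hco _ hx
  simp only [Finsupp.single_eq_same] at ci
  have h10 : (Finsupp.single (1 : Fin 2) j) 0 = 0 := by simp
  rw [h10] at c0
  have hdeg : h.degree ≠ 0 := by
    have : (i : WithBot ℕ) ≤ h.degree := Polynomial.le_degree_of_ne_zero (by rw [ci]; exact hx)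
    intro h0
    rw [h0] at this
    have : i ≤ 0 := by exact_mod_cast this
    omega
  obtain ⟨ξ, hξ⟩ := IsAlgClosed.exists_root h hdeg
  refine ⟨ξ, ?_, ?_⟩
  · rintro rfl
    rw [Polynomial.IsRoot, ← Polynomial.coeff_zero_eq_eval_zero, c0] at hξ
    exact hy hξ
  · have := hξ
    simpa [Polynomial.IsRoot, h, Polynomial.eval_finsetSum] using this

theorem shape_dvd {H : MvPolynomial (Fin 2) K} {w1 w2 r : ℕ} (h1 : 0 < w1) (h2 : 0 < w2)
    (hw : w1.Coprime w2)
    (hH : ∀ d, coeff d H ≠ 0 → w1 * d 0 + w2 * d 1 = w1 * w2 * r) {ξ : K}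
    (hξ : ∑ d ∈ H.support, coeff d H * ξ ^ (d 0) = 0) :
    (X 0 ^ w2 - C (ξ ^ w2) * X 1 ^ w1) ∣ H := by
  have e : H = ∑ d ∈ H.support, (monomial d (coeff d H) -
      C (coeff d H * ξ ^ (d 0)) * X 1 ^ (w1 * r)) := by
    rw [Finset.sum_sub_distrib, ← Finset.sum_mul, ← map_sum, hξ]
    simp
  rw [e]
  refine Finset.dvd_sum fun d hd => ?_
  have hd' := hH d (mem_support_iff.1 hd)
  obtain ⟨k, hk⟩ : w2 ∣ d 0 := by
    apply hw.symm.dvd_of_dvd_mul_left (m := w1)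
    have : w2 ∣ w1 * d 0 + w2 * d 1 := by rw [hd']; exact ⟨w1 * r, by ring⟩
    exact (Nat.dvd_add_left ⟨d 1, rfl⟩).1 this
  obtain ⟨l, hl⟩ : w1 ∣ d 1 := by
    apply hw.dvd_of_dvd_mul_left (m := w2)
    have : w1 ∣ w1 * d 0 + w2 * d 1 := by rw [hd']; exact ⟨w2 * r, by ring⟩
    exact (Nat.dvd_add_right ⟨d 0, rfl⟩).1 this
  have hm : monomial d (coeff d H) = C (coeff d H) * (X 0 ^ (d 0) * X 1 ^ (d 1)) := by
    rw [monomial_eq, Finsupp.prod_fintype _ _ (by simp)]; simp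
  have hkl : k + l = r := by
    rw [hk, hl] at hd'
    have : (w1 * w2) * (k + l) = (w1 * w2) * r := by rw [← hd']; ring
    exact Nat.eq_of_mul_eq_mul_left (Nat.mul_pos h1 h2) this
  have : monomial d (coeff d H) - C (coeff d H * ξ ^ (d 0)) * X 1 ^ (w1 * r) =
      C (coeff d H) * X 1 ^ (w1 * l) *
        ((X 0 ^ w2) ^ k - (C (ξ ^ w2) * X 1 ^ w1) ^ k) := by
    rw [hm, hk, hl, ← hkl]
    simp only [map_mul, map_pow]; ring
  rw [this]
  exact Dvd.dvd.mul_left (sub_dvd_pow_sub_pow _ _ k) _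

theorem shape [CharZero K] [IsAlgClosed K] {H : MvPolynomial (Fin 2) K} {w1 w2 r : ℕ}
    (h1 : 2 ≤ w1) (h2 : 2 ≤ w2) (hr : 0 < r) (hw : w1.Coprime w2)
    (hH : ∀ d, coeff d H ≠ 0 → w1 * d 0 + w2 * d 1 = w1 * w2 * r)
    (hx : coeff (Finsupp.single 0 (w2 * r)) H ≠ 0) (hy : coeff (Finsupp.single 1 (w1 * r)) H ≠ 0)
    (hl : LND (jacD H)) : False := by
  obtain ⟨ξ, hξ, hs⟩ := shape_root (i := w2 * r) (j := w1 * r) (Nat.mul_pos (by omega) hr)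
    (fun d hd => by have := hH d hd; linear_combination r * this) hx hy
  obtain ⟨g, hg⟩ := shape_dvd (by omega) (by omega) hw hH hs
  have hH0 : H ≠ 0 := by rintro rfl; simp at hx
  set D := jacD H with hD
  have hDH : D H = 0 := by rw [hD, jacD_apply, jac_self]
  have hu : D (X 0 ^ w2 - C (ξ ^ w2) * X 1 ^ w1) = 0 :=
    hl.ker_of_mul (by rwa [← hg]) (by rw [← hg]; exact hDH)
  have hDC : D (C (ξ ^ w2)) = 0 := by
    have : (C (ξ ^ w2) : MvPolynomial (Fin 2) K) = algebraMap K _ (ξ ^ w2) := rfl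
    rw [this]; exact D.map_algebraMap _
  rw [map_sub, Derivation.leibniz, hDC, Derivation.leibniz_pow, Derivation.leibniz_pow] at hu
  simp only [smul_eq_mul, nsmul_eq_mul, mul_zero, add_zero] at hu
  have hXne : ¬ (X 1 : MvPolynomial (Fin 2) K) ∣ X 0 := by
    rw [X_dvd_X]; simp
  have hXne' : ¬ (X 0 : MvPolynomial (Fin 2) K) ∣ X 1 := by
    rw [X_dvd_X]; simp
  have p0 : Prime (X 0 : MvPolynomial (Fin 2) K) := X_prime
  have p1 : Prime (X 1 : MvPolynomial (Fin 2) K) := X_prime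
  have unit : ∀ n : ℕ, n ≠ 0 → IsUnit (n : MvPolynomial (Fin 2) K) := by
    intro n hn
    rw [← map_natCast (C : K →+* MvPolynomial (Fin 2) K)]
    exact (IsUnit.mk0 _ (by exact_mod_cast hn)).map C
  have unitξ : IsUnit (C (ξ ^ w2) : MvPolynomial (Fin 2) K) :=
    (IsUnit.mk0 _ (pow_ne_zero _ hξ)).map C
  have hb1 : X 1 ∣ D (X 0) := by
    have : (X 1 : MvPolynomial (Fin 2) K) ∣ (w2 : MvPolynomial (Fin 2) K) *
        (X 0 ^ (w2 - 1) * D (X 0)) := by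
      rw [sub_eq_zero.1 hu]
      refine Dvd.dvd.mul_left (Dvd.dvd.mul_left (Dvd.dvd.mul_right (dvd_pow_self _ ?_) _) _) _
      omega
    rw [(unit w2 (by omega)).dvd_mul_left] at this
    rcases p1.dvd_or_dvd this with h | h
    · exact absurd (p1.dvd_of_dvd_pow h) hXne
    · exact h
  have hb0 : X 0 ∣ D (X 1) := by
    have : (X 0 : MvPolynomial (Fin 2) K) ∣ C (ξ ^ w2) * ((w1 : MvPolynomial (Fin 2) K) *
        (X 1 ^ (w1 - 1) * D (X 1))) := by
      rw [← sub_eq_zero.1 hu]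
      refine (Dvd.dvd.mul_left (Dvd.dvd.mul_right (dvd_pow_self _ ?_) _) _)
      omega
    rw [unitξ.dvd_mul_left, (unit w1 (by omega)).dvd_mul_left] at this
    rcases p0.dvd_or_dvd this with h | h
    · exact absurd (p0.dvd_of_dvd_pow h) hXne'
    · exact h
  obtain ⟨a, ha⟩ := hb1
  obtain ⟨b, hb⟩ := hb0
  rcases hl.no_cross ha hb with h | h
  · rw [hD, jacD_apply] at h
    have h3 : pderiv 1 H = 0 := by simpa [Jac] using h
    have := pderiv_eq_zero_coeff h3 hy
    simp at this; omega
  · rw [hD, jacD_apply] at h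
    have h3 : pderiv 0 H = 0 := by simpa [Jac] using h
    have := pderiv_eq_zero_coeff h3 hx
    simp at this; omega

end shape


/-! ### Composition and degrees -/
section comp
variable {K : Type*} [Field K]

theorem hom_sum (f : MvPolynomial (Fin 2) K →ₐ[K] MvPolynomial (Fin 2) K)
    (A : MvPolynomial (Fin 2) K) :
    f A = ∑ d ∈ A.support, C (coeff d A) * (f (X 0) ^ (d 0) * f (X 1) ^ (d 1)) := by
  conv_lhs => rw [A.as_sum]
  rw [map_sum]
  refine Finset.sum_congr rfl fun d _ => ?_
  have hm : monomial d (coeff d A) = C (coeff d A) * (X 0 ^ (d 0) * X 1 ^ (d 1)) := by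
    rw [monomial_eq, Finsupp.prod_fintype _ _ (by simp)]; simp
  have hC : f (C (coeff d A)) = C (coeff d A) := f.commutes _
  rw [hm, map_mul, map_mul, map_pow, map_pow, hC]

variable {s t μ r : ℝ} {f f' : MvPolynomial (Fin 2) K →ₐ[K] MvPolynomial (Fin 2) K}
  {A : MvPolynomial (Fin 2) K}

theorem comp_mono (h0 : LEw s (f (X 0)) (t * μ)) (h1 : LEw s (f (X 1)) μ) (d : Fin 2 →₀ ℕ) (c : K) :
    LEw s (C c * (f (X 0) ^ (d 0) * f (X 1) ^ (d 1))) (μ * wt t d) := by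
  refine (((h0.pow (d 0)).mul (h1.pow (d 1))).C_mul c).mono (le_of_eq ?_)
  unfold wt; ring

theorem comp_le (hμ : 0 ≤ μ) (h0 : LEw s (f (X 0)) (t * μ)) (h1 : LEw s (f (X 1)) μ)
    (hA : LEw t A r) : LEw s (f A) (μ * r) := by
  rw [hom_sum]
  refine LEw.sum _ _ fun d hd => ?_
  exact (comp_mono h0 h1 d _).mono
    (mul_le_mul_of_nonneg_left (hA d (mem_support_iff.1 hd)) hμ)

theorem comp_lt (hμ : 0 < μ) (h0 : LEw s (f (X 0)) (t * μ)) (h1 : LEw s (f (X 1)) μ)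
    (hA : LTw t A r) : LTw s (f A) (μ * r) := by
  rw [hom_sum]
  refine LTw.sum _ _ fun d hd => ?_
  exact (comp_mono h0 h1 d _).lt
    (mul_lt_mul_of_pos_left (hA d (mem_support_iff.1 hd)) hμ)

theorem pow_sub_lt {p q : MvPolynomial (Fin 2) K} (hp : LEw s p r) (hq : LEw s q r)
    (h : LTw s (p - q) r) (n : ℕ) : LTw s (p ^ n - q ^ n) (n * r) := by
  induction n with
  | zero => simpa using LTw.zero
  | succ n ih =>
    have e : p ^ (n + 1) - q ^ (n + 1) = p ^ n * (p - q) + (p ^ n - q ^ n) * q := by ring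
    have er : ((n + 1 : ℕ) : ℝ) * r = n * r + r := by push_cast; ring
    rw [e, er]
    exact ((hp.pow n).mul_lt h).add (ih.mul_le hq)

theorem comp_diff (hμ : 0 ≤ μ) (h0 : LEw s (f (X 0)) (t * μ)) (h1 : LEw s (f (X 1)) μ)
    (h0' : LEw s (f' (X 0)) (t * μ)) (h1' : LEw s (f' (X 1)) μ)
    (k0 : LTw s (f (X 0) - f' (X 0)) (t * μ)) (k1 : LTw s (f (X 1) - f' (X 1)) μ)
    (hA : LEw t A r) : LTw s (f A - f' A) (μ * r) := by
  rw [hom_sum f, hom_sum f', ← Finset.sum_sub_distrib]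
  refine LTw.sum _ _ fun d hd => ?_
  have e : C (coeff d A) * (f (X 0) ^ (d 0) * f (X 1) ^ (d 1)) -
      C (coeff d A) * (f' (X 0) ^ (d 0) * f' (X 1) ^ (d 1)) =
      C (coeff d A) * (f (X 0) ^ (d 0) * (f (X 1) ^ (d 1) - f' (X 1) ^ (d 1)) +
        (f (X 0) ^ (d 0) - f' (X 0) ^ (d 0)) * f' (X 1) ^ (d 1)) := by ring
  rw [e]
  have h3 := ((h0.pow (d 0)).mul_lt (pow_sub_lt h1 h1' k1 (d 1))).add
    ((pow_sub_lt h0 h0' k0 (d 0)).mul_le (h1'.pow (d 1)))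
  refine (h3.C_mul _).mono ?_
  have := mul_le_mul_of_nonneg_left (hA d (mem_support_iff.1 hd)) hμ
  unfold wt at this
  linarith

/-- A unique dominating monomial controls the degree of a composition. -/
theorem comp_dom (hμ : 0 < μ) (h0 : dg s (f (X 0)) = t * μ) (h1 : dg s (f (X 1)) = μ)
    (hn0 : f (X 0) ≠ 0) {d} (hd : coeff d A ≠ 0)
    (hdom : ∀ e, coeff e A ≠ 0 → e ≠ d → wt t e < wt t d) :
    dg s (f A) = μ * wt t d ∧ f A ≠ 0 := by
  classical
  have hn1 : f (X 1) ≠ 0 := ne_zero_of_dg_pos (t := s) (by rw [h1]; exact hμ)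
  have l0 : LEw s (f (X 0)) (t * μ) := by rw [← h0]; exact LEw_dg _ _
  have l1 : LEw s (f (X 1)) μ := by conv => { arg 3; rw [← h1] }; exact LEw_dg _ _
  set M := monomial d (coeff d A) with hM
  have hlow : LTw t (A - M) (wt t d) := by
    intro e he
    rw [coeff_sub, hM, coeff_monomial] at he
    by_cases hed : e = d
    · subst hed; simp at he
    · rw [if_neg (Ne.symm hed), sub_zero] at he
      exact hdom e he hed
  have hmain : f M = C (coeff d A) * (f (X 0) ^ (d 0) * f (X 1) ^ (d 1)) := by
    have hm : M = C (coeff d A) * (X 0 ^ (d 0) * X 1 ^ (d 1)) := by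
      rw [hM, monomial_eq, Finsupp.prod_fintype _ _ (by simp)]; simp
    have hC : f (C (coeff d A)) = C (coeff d A) := f.commutes _
    rw [hm, map_mul, map_mul, map_pow, map_pow, hC]
  have hne : f (X 0) ^ (d 0) * f (X 1) ^ (d 1) ≠ 0 :=
    mul_ne_zero (pow_ne_zero _ hn0) (pow_ne_zero _ hn1)
  have hMne : f M ≠ 0 := by
    rw [hmain]; exact mul_ne_zero (by simpa using hd) hne
  have hdgM : dg s (f M) = μ * wt t d := by
    rw [hmain, dg_C_mul s hd hne, dg_mul s (pow_ne_zero _ hn0) (pow_ne_zero _ hn1),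
      dg_pow s hn0, dg_pow s hn1, h0, h1]
    unfold wt; ring
  have hlt := comp_lt hμ l0 l1 hlow
  rw [← hdgM] at hlt
  have e : f A = f M + f (A - M) := by rw [← map_add]; congr 1; ring
  rw [e]
  exact ⟨by rw [dg_add_lt hMne hlt, hdgM], add_ne_zero_of_lt hMne hlt⟩

theorem trifil (ht : 0 < t) {α β : K} (hα : α ≠ 0) (hβ : β ≠ 0)
    (h0 : LTw t (f (X 0) - C α * X 0) t) (h1 : LTw t (f (X 1) - C β * X 1) 1) 
    (p : MvPolynomial (Fin 2) K) (hp : p ≠ 0) : dg t (f p) = dg t p ∧ f p ≠ 0 := by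
  let τ : MvPolynomial (Fin 2) K →ₐ[K] MvPolynomial (Fin 2) K := aeval ![C α * X 0, C β * X 1]
  have τ0 : τ (X 0) = C α * X 0 := by simp [τ]
  have τ1 : τ (X 1) = C β * X 1 := by simp [τ]
  have t0 : LEw t (τ (X 0)) (t * 1) := by rw [τ0, mul_one]; exact HOM.X0.le.C_mul _
  have t1 : LEw t (τ (X 1)) 1 := by rw [τ1]; exact HOM.X1.le.C_mul _
  have k0 : LTw t (f (X 0) - τ (X 0)) (t * 1) := by rw [τ0, mul_one]; exact h0
  have k1 : LTw t (f (X 1) - τ (X 1)) 1 := by rw [τ1]; exact h1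
  have f0 : LEw t (f (X 0)) (t * 1) := by
    have := k0.le.add t0; rwa [sub_add_cancel] at this
  have f1 : LEw t (f (X 1)) 1 := by
    have := k1.le.add t1; rwa [sub_add_cancel] at this
  have hd := comp_diff zero_le_one f0 f1 t0 t1 k0 k1 (LEw_dg t p)
  have hc : ∀ d, coeff d (τ p) = coeff d p * (α ^ (d 0) * β ^ (d 1)) := by
    classical
    intro d
    rw [hom_sum τ p, coeff_sum, Finset.sum_eq_single d]
    · rw [τ0, τ1]
      have : C (coeff d p) * ((C α * X 0) ^ (d 0) * (C β * X 1) ^ (d 1)) =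
        monomial d (coeff d p * (α ^ (d 0) * β ^ (d 1))) := by
        rw [monomial_eq, Finsupp.prod_fintype _ _ (by simp)]; simp; ring
      rw [this, coeff_monomial, if_pos rfl]
    · intro e _ hne
      rw [τ0, τ1]
      have : C (coeff e p) * ((C α * X 0) ^ (e 0) * (C β * X 1) ^ (e 1)) =
        monomial e (coeff e p * (α ^ (e 0) * β ^ (e 1))) := by
        rw [monomial_eq, Finsupp.prod_fintype _ _ (by simp)]; simp; ring
      rw [this, coeff_monomial, if_neg hne]
    · intro h
      rw [notMem_support_iff] at h
      simp [h]
  have hsupp : ∀ d, coeff d (τ p) ≠ 0 ↔ coeff d p ≠ 0 := by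
    intro d
    rw [hc, mul_ne_zero_iff]
    exact ⟨fun h => h.1, fun h => ⟨h, mul_ne_zero (pow_ne_zero _ hα) (pow_ne_zero _ hβ)⟩⟩
  have hτp : τ p ≠ 0 := by
    obtain ⟨d, hd⟩ := MvPolynomial.ne_zero_iff.1 hp
    exact MvPolynomial.ne_zero_iff.2 ⟨d, (hsupp d).2 hd⟩
  have hdg : dg t (τ p) = dg t p := by
    apply dg_congr_support
    ext d; rw [mem_support_iff, mem_support_iff]; exact hsupp d
  rw [one_mul, ← hdg] at hd
  have e : f p = τ p + (f p - τ p) := by ring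
  rw [e]
  exact ⟨by rw [dg_add_lt hτp hd, hdg], add_ne_zero_of_lt hτp hd⟩

theorem dg_zero (t : ℝ) : dg t (0 : MvPolynomial (Fin 2) K) = 0 := by
  have := dg_C t (0 : K); rwa [map_zero] at this

theorem trifil' (ht : 0 < t) {α β : K} (hα : α ≠ 0) (hβ : β ≠ 0)
    (h0 : LTw t (f (X 0) - C α * X 0) t) (h1 : LTw t (f (X 1) - C β * X 1) 1) 
    (p : MvPolynomial (Fin 2) K) : dg t (f p) = dg t p := by
  by_cases hp : p = 0
  · rw [hp, map_zero]
  · exact (trifil ht hα hβ h0 h1 p hp).1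

end comp


/-! ### Invariance under automorphisms -/
section tame
variable {K : Type*} [Field K]

theorem exch_X0 : exch K (X 0) = X 1 := by simp [exch]
theorem exch_X1 : exch K (X 1) = X 0 := by simp [exch]
theorem exch_exch (p : MvPolynomial (Fin 2) K) : exch K (exch K p) = p := by
  have : ((exch K).toAlgHom.comp (exch K).toAlgHom) = AlgHom.id K _ := by
    ext i; fin_cases i
    · change coeff _ (exch K (exch K (X 0))) = _; rw [exch_X0, exch_X1]; rfl
    · change coeff _ (exch K (exch K (X 1))) = _; rw [exch_X1, exch_X0]; rfl
  exact DFunLike.congr_fun this p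

theorem dg_exch (p : MvPolynomial (Fin 2) K) : dg 1 (exch K p) = dg 1 p := by
  have key : ∀ p : MvPolynomial (Fin 2) K, p ≠ 0 → dg 1 (exch K p) ≤ dg 1 p := by
    intro p hp
    apply dg_le (by simpa using hp)
    have := comp_le (s := 1) (t := 1) (μ := 1) (f := (exch K).toAlgHom) (A := p) zero_le_one
      (by change LEw 1 (exch K (X 0)) _; rw [exch_X0, mul_one]; exact HOM.X1.le)
      (by change LEw 1 (exch K (X 1)) _; rw [exch_X1]; exact HOM.X0.le) (LEw_dg 1 p)
    rw [one_mul] at this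
    exact this
  by_cases hp : p = 0
  · rw [hp, map_zero]
  · apply le_antisymm (key p hp)
    have := key (exch K p) (by simpa using hp)
    rwa [exch_exch] at this

/-- The elementary automorphism `x ↦ x + ξ y^k`. -/
noncomputable def elem (ξ : K) (k : ℕ) : MvPolynomial (Fin 2) K ≃ₐ[K] MvPolynomial (Fin 2) K :=
  AlgEquiv.ofAlgHom (aeval ![X 0 + C ξ * X 1 ^ k, X 1]) (aeval ![X 0 - C ξ * X 1 ^ k, X 1])
    (by ext i; fin_cases i <;> simp) (by ext i; fin_cases i <;> simp)

theorem elem_X0 (ξ : K) (k : ℕ) : elem ξ k (X 0) = X 0 + C ξ * X 1 ^ k := by simp [elem]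
theorem elem_X1 (ξ : K) (k : ℕ) : elem ξ k (X 1) = X 1 := by simp [elem]
theorem dg_elem (ξ : K) (k : ℕ) (p : MvPolynomial (Fin 2) K) :
    dg (k + 1) (elem ξ k p) = dg (k + 1) p := by
  refine trifil' (f := (elem ξ k).toAlgHom) (by positivity) (α := 1) (β := 1) one_ne_zero
    one_ne_zero ?_ ?_ p
  · change LTw _ (elem ξ k (X 0) - _) _
    rw [elem_X0]
    have : (X 0 + C ξ * X 1 ^ k - C 1 * X 0 : MvPolynomial (Fin 2) K) = C ξ * X 1 ^ k := by
      simp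
    rw [this]
    refine ((HOM.X1.pow k).le.C_mul ξ).lt (by linarith)
  · change LTw _ (elem ξ k (X 1) - _) _
    rw [elem_X1]
    simpa using LTw.zero

theorem jac_equiv' (σ : MvPolynomial (Fin 2) K ≃ₐ[K] MvPolynomial (Fin 2) K)
    {p q : MvPolynomial (Fin 2) K} {c : K} (hc : c ≠ 0) (hJ : Jac p q = C c) :
    ∃ c' : K, c' ≠ 0 ∧ Jac (σ p) (σ q) = C c' := by
  obtain ⟨e, he, h⟩ := jac_equiv σ
  refine ⟨c * e, mul_ne_zero hc he, ?_⟩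
  have : Jac (σ p) (σ q) = σ (Jac p q) * Jac (σ (X 0)) (σ (X 1)) := jac_hom σ.toAlgHom p q
  have hC : σ (C c) = C c := σ.commutes c
  rw [this, hJ, h, hC, C_mul]

variable [CharZero K]

/-- extremal `x`-monomial -/
theorem coord_x {B : MvPolynomial (Fin 2) K} (hl : LND (jacD B)) {i j : ℕ} (hi : 0 < i)
    (h0 : ∀ d, coeff d B ≠ 0 → d 0 ≤ i) (h1 : ∀ d, coeff d B ≠ 0 → d 1 ≤ j)
    (hd : ∃ d, coeff d B ≠ 0 ∧ d 0 = i) : coeff (Finsupp.single 0 i) B ≠ 0 := by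
  obtain ⟨d, hd, hdi⟩ := hd
  obtain ⟨H, hH⟩ := exists_lead ((j : ℝ) + 1) B
  have hB : B ≠ 0 := by rintro rfl; simp at hd
  have hdB : ((j : ℝ) + 1) * i ≤ dg ((j : ℝ) + 1) B := by
    have := le_dg (t := (j : ℝ) + 1) hd
    rw [wt, hdi] at this
    have h2 : (0 : ℝ) ≤ d 1 := by positivity
    linarith
  have hsup : ∀ e, coeff e H ≠ 0 → coeff e B ≠ 0 := fun e he => by
    rw [← hH.coeff_eq (hH.1 e he)]; exact he
  have hge : ∀ e, coeff e H ≠ 0 → i ≤ e 0 := by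
    intro e he
    by_contra hh
    have h2 := hH.1 e he
    rw [← h2, wt] at hdB
    have h3 : (e 0 : ℝ) + 1 ≤ i := by exact_mod_cast (by omega : e 0 + 1 ≤ i)
    have h4 : (e 1 : ℝ) ≤ j := by exact_mod_cast h1 e (hsup e he)
    nlinarith
  have hlH := hl.lead hH
  have hH0 := hH.ne_zero hB
  have hp := hlH.pure0 hH0 (fun e he => by have := hge e he; omega)
  obtain ⟨e, he⟩ := MvPolynomial.ne_zero_iff.1 hH0
  have : e = Finsupp.single 0 i := by
    apply fin2_ext
    · simp; exact le_antisymm (h0 e (hsup e he)) (hge e he)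
    · simp [hp e he]
  rw [← this]; exact hsup e he

theorem coord_y {B : MvPolynomial (Fin 2) K} (hl : LND (jacD B)) {i j : ℕ} (hj : 0 < j)
    (h0 : ∀ d, coeff d B ≠ 0 → d 0 ≤ i) (h1 : ∀ d, coeff d B ≠ 0 → d 1 ≤ j)
    (hd : ∃ d, coeff d B ≠ 0 ∧ d 1 = j) : coeff (Finsupp.single 1 j) B ≠ 0 := by
  obtain ⟨d, hd, hdi⟩ := hd
  set t : ℝ := 1 / (i + 1) with ht
  have hti : t * i < 1 := by
    rw [ht, div_mul_eq_mul_div, div_lt_one (by positivity)]; linarith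
  have ht0 : 0 < t := by positivity
  obtain ⟨H, hH⟩ := exists_lead t B
  have hB : B ≠ 0 := by rintro rfl; simp at hd
  have hdB : (j : ℝ) ≤ dg t B := by
    have := le_dg (t := t) hd
    rw [wt, hdi] at this
    have h2 : (0 : ℝ) ≤ t * d 0 := by positivity
    linarith
  have hsup : ∀ e, coeff e H ≠ 0 → coeff e B ≠ 0 := fun e he => by
    rw [← hH.coeff_eq (hH.1 e he)]; exact he
  have hge : ∀ e, coeff e H ≠ 0 → j ≤ e 1 := by
    intro e he
    by_contra hh
    have h2 := hH.1 e he
    rw [← h2, wt] at hdB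
    have h3 : (e 1 : ℝ) + 1 ≤ j := by exact_mod_cast (by omega : e 1 + 1 ≤ j)
    have h4 : (e 0 : ℝ) ≤ i := by exact_mod_cast h0 e (hsup e he)
    nlinarith
  have hlH := hl.lead hH
  have hH0 := hH.ne_zero hB
  have hp := hlH.pure1 hH0 (fun e he => by have := hge e he; omega)
  obtain ⟨e, he⟩ := MvPolynomial.ne_zero_iff.1 hH0
  have : e = Finsupp.single 1 j := by
    apply fin2_ext
    · simp [hp e he]
    · simp; exact le_antisymm (h1 e (hsup e he)) (hge e he)
  rw [← this]; exact hsup e he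

/-- leading form of a coordinate -/
theorem coord_lead {B : MvPolynomial (Fin 2) K} (hl : LND (jacD B)) {i j : ℕ} (hi : 0 < i)
    (h0 : ∀ d, coeff d B ≠ 0 → d 0 ≤ i) (h1 : ∀ d, coeff d B ≠ 0 → d 1 ≤ j)
    (hx : coeff (Finsupp.single 0 i) B ≠ 0) (hy : coeff (Finsupp.single 1 j) B ≠ 0) :
    dg ((j : ℝ) / i) B = j := by
  set t : ℝ := j / i with ht
  have hi' : (0 : ℝ) < i := by exact_mod_cast hi
  have ht0 : 0 ≤ t := by positivity
  have hti : t * i = j := by rw [ht]; field_simp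
  obtain ⟨H, hH⟩ := exists_lead t B
  have hB : B ≠ 0 := by rintro rfl; simp at hx
  have hH0 := hH.ne_zero hB
  have hsup : ∀ e, coeff e H ≠ 0 → coeff e B ≠ 0 := fun e he => by
    rw [← hH.coeff_eq (hH.1 e he)]; exact he
  apply le_antisymm
  · by_cases hh : ∃ d, coeff d H ≠ 0 ∧ d 0 = 0
    · obtain ⟨d, hd, hd0⟩ := hh
      have := hH.1 d hd
      rw [← this, wt, hd0]
      have : (d 1 : ℝ) ≤ j := by exact_mod_cast h1 d (hsup d hd)
      simpa using this
    · push Not at hh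
      have hp := (hl.lead hH).pure0 hH0 hh
      obtain ⟨d, hd⟩ := MvPolynomial.ne_zero_iff.1 hH0
      have := hH.1 d hd
      rw [← this, wt, hp d hd]
      have : (d 0 : ℝ) ≤ i := by exact_mod_cast h0 d (hsup d hd)
      rw [← hti]
      simpa using mul_le_mul_of_nonneg_left this ht0
  · have := le_dg (t := t) hy
    rwa [wt_single1] at this

end tame


section tame2
variable {K : Type*} [Field K] [CharZero K]

/-- Triangular automorphisms. -/
theorem t1_base {a b : ℕ} (ha : 2 ≤ a) (hab : a < b) (hco : a.Coprime b)
    (σ : MvPolynomial (Fin 2) K ≃ₐ[K] MvPolynomial (Fin 2) K)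
    (hσ : ∀ d, coeff d (σ (X 1)) ≠ 0 → d 0 = 0)
    {p q : MvPolynomial (Fin 2) K} {c : K} (hc : c ≠ 0) (hJ : Jac p q = C c)
    (h : Pi' a b 1 p q) : Pi' a b 1 (σ p) (σ q) := by
  obtain ⟨e, he, hJσ⟩ := jac_equiv σ
  obtain ⟨c', hc', hJ'⟩ := jac_equiv' σ hc hJ
  have hB0 : pderiv 0 (σ (X 1)) = 0 := by
    ext d
    rw [coeff_pderiv, coeff_zero]
    by_contra hh
    have := hσ _ (left_ne_zero_of_mul hh)
    simp at this
  rw [Jac, hB0, mul_zero, sub_zero] at hJσ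
  have hu : IsUnit (C e : MvPolynomial (Fin 2) K) := (IsUnit.mk0 _ he).map C
  rw [← hJσ] at hu
  obtain ⟨α, hα, hA⟩ := (MvPolynomial.isUnit_iff_eq_C_of_isReduced).1 (isUnit_of_mul_isUnit_left hu)
  obtain ⟨β, hβ, hB⟩ := (MvPolynomial.isUnit_iff_eq_C_of_isReduced).1 (isUnit_of_mul_isUnit_right hu)
  set f := σ (X 0) - C α * X 0 with hf
  have hf0 : pderiv 0 f = 0 := by
    rw [hf, map_sub, hA, pderiv_C_mul]; simp
  obtain ⟨n, hn⟩ := exists_nat_ge (dg 1 f)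
  have hn0 : (0 : ℝ) ≤ n := by positivity
  have hfl : LTw ((n : ℝ) + 1) f ((n : ℝ) + 1) := by
    intro d hd
    have h0 := pderiv_eq_zero_coeff hf0 hd
    have h1 := le_dg (t := 1) hd
    rw [wt, h0] at h1 ⊢
    simp only [Nat.cast_zero, mul_zero, zero_add] at h1 ⊢
    linarith
  obtain ⟨g, hg⟩ : ∃ g, σ (X 1) - C β * X 1 = C g := by
    apply const_of_pderiv
    · rw [map_sub, hB0, pderiv_C_mul]; simp
    · rw [map_sub, hB, pderiv_C_mul]; simp
  have hgl : LTw ((n : ℝ) + 1) (σ (X 1) - C β * X 1) 1 := by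
    rw [hg]; exact (HOM.C g).le.lt one_pos
  have hinv : ∀ z, dg ((n : ℝ) + 1) (σ z) = dg ((n : ℝ) + 1) z := fun z =>
    trifil' (f := σ.toAlgHom) (by positivity) hα.ne_zero hβ.ne_zero hfl hgl z
  have h1 : Pi' a b ((n : ℝ) + 1) p q := slemma ha hab hco hc hJ one_pos h (by positivity)
  have h2 : Pi' a b ((n : ℝ) + 1) (σ p) (σ q) := by
    unfold Pi' at h1 ⊢; rwa [hinv, hinv]
  exact slemma ha hab hco hc' hJ' (by positivity) h2 one_pos

theorem Pi'.exch {a b : ℕ} {p q : MvPolynomial (Fin 2) K} :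
    Pi' a b 1 (exch K p) (exch K q) ↔ Pi' a b 1 p q := by
  unfold Pi'; rw [dg_exch, dg_exch]

theorem degreeOf_attained {B : MvPolynomial (Fin 2) K} (hB : B ≠ 0) (i : Fin 2) :
    ∃ d, coeff d B ≠ 0 ∧ d i = degreeOf i B := by
  classical
  rw [degreeOf_eq_sup]
  obtain ⟨d, hd, h⟩ := Finset.exists_mem_eq_sup B.support (by simpa using hB) (fun d => d i)
  exact ⟨d, mem_support_iff.1 hd, h.symm⟩

theorem degreeOf_lt_of {B : MvPolynomial (Fin 2) K} {i : Fin 2} {n : ℕ}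
    (h : ∀ d, coeff d B ≠ 0 → d i ≤ n) : degreeOf i B ≤ n := by
  rw [degreeOf_eq_sup]
  exact Finset.sup_le fun d hd => h d (mem_support_iff.1 hd)

theorem le_degreeOf {B : MvPolynomial (Fin 2) K} (i : Fin 2) {d} (h : coeff d B ≠ 0) :
    d i ≤ degreeOf i B := by
  rw [degreeOf_eq_sup]
  exact Finset.le_sup (f := fun d : Fin 2 →₀ ℕ => d i) (mem_support_iff.2 h)

theorem t1_reduce [IsAlgClosed K] (σ : MvPolynomial (Fin 2) K ≃ₐ[K] MvPolynomial (Fin 2) K)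
    {i j : ℕ} (hi : 0 < i) (hij : i ≤ j)
    (hi' : degreeOf 0 (σ (X 1)) = i) (hj' : degreeOf 1 (σ (X 1)) = j) :
    ∃ (ξ : K) (k : ℕ), degreeOf 0 (elem ξ k (σ (X 1))) ≤ i ∧
      degreeOf 1 (elem ξ k (σ (X 1))) < j := by
  set B := σ (X 1) with hBdef
  have hl : LND (jacD B) := LND.coord σ
  have hB : B ≠ 0 := by rw [hBdef]; simp
  have h0 : ∀ d, coeff d B ≠ 0 → d 0 ≤ i := fun d hd => by rw [← hi']; exact le_degreeOf 0 hd
  have h1 : ∀ d, coeff d B ≠ 0 → d 1 ≤ j := fun d hd => by rw [← hj']; exact le_degreeOf 1 hd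
  have hx := coord_x hl hi h0 h1 (by rw [← hi']; exact degreeOf_attained hB 0)
  have hy := coord_y hl (by omega) h0 h1 (by rw [← hj']; exact degreeOf_attained hB 1)
  have hdg := coord_lead hl hi h0 h1 hx hy
  set t : ℝ := j / i with ht
  have hip : (0 : ℝ) < i := by exact_mod_cast hi
  have hti : t * i = j := by rw [ht]; field_simp
  obtain ⟨H, hH⟩ := exists_lead t B
  have hxH : coeff (Finsupp.single 0 i) H ≠ 0 := by
    rw [hH.coeff_eq (by rw [wt_single0, hdg, hti])]; exact hx
  have hyH : coeff (Finsupp.single 1 j) H ≠ 0 := by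
    rw [hH.coeff_eq (by rw [wt_single1, hdg])]; exact hy
  have hHn : ∀ d, coeff d H ≠ 0 → j * d 0 + i * d 1 = i * j := by
    intro d hd
    have h2 := hH.1 d hd
    rw [hdg, wt] at h2
    have : (j : ℝ) * d 0 + i * d 1 = i * j := by
      rw [← hti]; rw [← hti] at h2; linear_combination i * h2
    exact_mod_cast this
  have hlH := hl.lead hH
  obtain ⟨g, w1, w2, hg, hcop, e1, e2⟩ : ∃ g w1 w2 : ℕ, 0 < g ∧ w1.Coprime w2 ∧ j = w1 * g ∧
      i = w2 * g := by
    obtain ⟨w1, w2, h, h', h''⟩ := Nat.exists_coprime j i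
    exact ⟨_, w1, w2, Nat.gcd_pos_of_pos_right _ hi, h, h', h''⟩
  have hHw : ∀ d, coeff d H ≠ 0 → w1 * d 0 + w2 * d 1 = w1 * w2 * g := by
    intro d hd
    have := hHn d hd
    rw [e1, e2] at this
    apply Nat.eq_of_mul_eq_mul_left hg
    linear_combination this
  have hw21 : w2 = 1 := by
    by_contra hne
    have hw2 : w2 ≠ 0 := by rintro rfl; simp at e2; omega
    have hw12 : w2 ≤ w1 := by
      rw [e1, e2] at hij; exact Nat.le_of_mul_le_mul_right hij hg
    exact shape (by omega) (by omega) hg hcop hHw (by rwa [← e2]) (by rwa [← e1]) hlH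
  subst hw21
  rw [one_mul] at e2
  subst e2
  have hw1 : 0 < w1 := by
    rcases Nat.eq_zero_or_pos w1 with h | h
    · subst h; simp at e1; omega
    · exact h
  have htw : t = w1 := by rw [ht, e1]; push_cast; field_simp
  obtain ⟨ξ, hξ, hs⟩ := shape_root hi hHn hxH hyH
  obtain ⟨G, hG⟩ := shape_dvd hw1 one_pos hcop hHw hs
  refine ⟨ξ, w1, ?_⟩
  set E := elem ξ w1 with hE
  have E0 : LEw t (E.toAlgHom (X 0)) (t * 1) := by
    change LEw t (E (X 0)) _
    rw [hE, elem_X0, mul_one]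
    exact HOM.X0.le.add (((HOM.X1.pow w1).le.C_mul ξ).mono (by rw [htw]; simp))
  have E1 : LEw t (E.toAlgHom (X 1)) 1 := by
    change LEw t (E (X 1)) _
    rw [hE, elem_X1]; exact HOM.X1.le
  have hEB : LEw t (E B) j := by
    have := comp_le zero_le_one E0 E1 (LEw_dg t B)
    rw [one_mul, hdg] at this; exact this
  have hlow : LTw t (E (B - H)) j := by
    have := comp_lt one_pos E0 E1 hH.2
    rw [one_mul, hdg] at this; exact this
  have hy0 : coeff (Finsupp.single 1 j) (E B) = 0 := by
    have e : E B = E (B - H) + E H := by rw [← map_add]; congr 1; ring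
    rw [e, coeff_add]
    have z1 : coeff (Finsupp.single 1 j) (E (B - H)) = 0 := by
      by_contra hne
      have := hlow _ hne
      rw [wt_single1] at this
      exact lt_irrefl _ this
    have z2 : E H = X 0 * E G := by
      rw [hG, map_mul]
      congr 1
      have hC : ∀ z, E (C z) = C z := fun z => E.commutes z
      rw [pow_one, pow_one, map_sub, map_mul, map_pow, hC, hE, elem_X0, elem_X1]
      simp
    rw [z1, z2, coeff_X_mul']
    simp
  have hnat : ∀ d, coeff d (E B) ≠ 0 → w1 * d 0 + d 1 ≤ w1 * i := by
    intro d hd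
    have := hEB d hd
    rw [wt, htw, e1] at this
    exact_mod_cast this
  constructor
  · refine degreeOf_lt_of fun d hd => ?_
    have := hnat d hd
    exact Nat.le_of_mul_le_mul_left (by omega) hw1
  · have : degreeOf 1 (E B) ≤ j - 1 := by
      refine degreeOf_lt_of fun d hd => ?_
      have h2 := hnat d hd
      by_contra hh
      have hd1 : d 1 = j := by omega
      have hd0 : d 0 = 0 := by
        have : w1 * d 0 = 0 := by omega
        rcases Nat.mul_eq_zero.1 this with h | h <;> omega
      apply hd
      rw [← hy0]
      congr 1
      exact fin2_ext (by simp [hd0]) (by simp [hd1])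
    omega

theorem t1_closed [IsAlgClosed K] {a b : ℕ} (ha : 2 ≤ a) (hab : a < b) (hco : a.Coprime b) (n : ℕ) :
    ∀ (σ : MvPolynomial (Fin 2) K ≃ₐ[K] MvPolynomial (Fin 2) K),
    degreeOf 0 (σ (X 1)) + degreeOf 1 (σ (X 1)) = n →
    ∀ {p q : MvPolynomial (Fin 2) K} {c : K}, c ≠ 0 → Jac p q = C c →
    Pi' a b 1 p q → Pi' a b 1 (σ p) (σ q) := by
  induction n using Nat.strong_induction_on with
  | _ n ih =>
    have main : ∀ (σ : MvPolynomial (Fin 2) K ≃ₐ[K] MvPolynomial (Fin 2) K),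
      degreeOf 0 (σ (X 1)) + degreeOf 1 (σ (X 1)) = n →
      degreeOf 0 (σ (X 1)) ≤ degreeOf 1 (σ (X 1)) →
      ∀ {p q : MvPolynomial (Fin 2) K} {c : K}, c ≠ 0 → Jac p q = C c →
      Pi' a b 1 p q → Pi' a b 1 (σ p) (σ q) := by
      intro σ hn hle p q c hc hJ hP
      rcases Nat.eq_zero_or_pos (degreeOf 0 (σ (X 1))) with h | h
      · exact t1_base ha hab hco σ (fun d hd => by have := le_degreeOf 0 hd; omega) hc hJ hP
      · obtain ⟨ξ, k, h1, h2⟩ := t1_reduce σ h hle rfl rfl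
        have hlt : degreeOf 0 ((σ.trans (elem ξ k)) (X 1)) +
            degreeOf 1 ((σ.trans (elem ξ k)) (X 1)) < n := by
          simp only [AlgEquiv.trans_apply]
          omega
        have hP' := ih _ hlt (σ.trans (elem ξ k)) rfl hc hJ hP
        obtain ⟨c1, hc1, hJ1⟩ := jac_equiv' (σ.trans (elem ξ k)) hc hJ
        obtain ⟨c2, hc2, hJ2⟩ := jac_equiv' σ hc hJ
        have hk : (0 : ℝ) < (k : ℝ) + 1 := by positivity
        have h3 := slemma ha hab hco hc1 hJ1 one_pos hP' hk
        simp only [AlgEquiv.trans_apply] at h3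
        unfold Pi' at h3
        rw [dg_elem, dg_elem] at h3
        exact slemma ha hab hco hc2 hJ2 hk h3 one_pos
    intro σ hn p q c hc hJ hP
    rcases le_total (degreeOf 0 (σ (X 1))) (degreeOf 1 (σ (X 1))) with h | h
    · exact main σ hn h hc hJ hP
    · have e0 : degreeOf 0 (exch K (σ (X 1))) = degreeOf 1 (σ (X 1)) := by
        have := degreeOf_rename_of_injective (p := σ (X 1)) (Equiv.swap (0 : Fin 2) 1).injective 1
        simpa [exch] using this
      have e1 : degreeOf 1 (exch K (σ (X 1))) = degreeOf 0 (σ (X 1)) := by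
        have := degreeOf_rename_of_injective (p := σ (X 1)) (Equiv.swap (0 : Fin 2) 1).injective 0
        simpa [exch] using this
      have := main (σ.trans (exch K)) (by simp only [AlgEquiv.trans_apply]; omega)
        (by simp only [AlgEquiv.trans_apply]; omega) hc hJ hP
      simp only [AlgEquiv.trans_apply] at this
      exact Pi'.exch.1 this

end tame2


/-! ### Unique dominating monomials, and base change -/
section basechange
variable {K : Type*} [Field K] [CharZero K]

/-- `A` has a unique monomial of maximal weight. -/
def Dom (t : ℝ) (A : MvPolynomial (Fin 2) K) : Prop :=
  ∃ d, coeff d A ≠ 0 ∧ ∀ e, coeff e A ≠ 0 → e ≠ d → wt t e < wt t d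

theorem dom_of_lead {t : ℝ} {B H : MvPolynomial (Fin 2) K} (hH : IsLead t B H) {d}
    (hd : coeff d H ≠ 0) (hu : ∀ e, coeff e H ≠ 0 → e = d) : Dom t B := by
  have hdw := hH.1 d hd
  refine ⟨d, by rwa [← hH.coeff_eq hdw], fun e he hne => ?_⟩
  rw [hdw]
  refine lt_of_le_of_ne (le_dg he) fun h => hne (hu e ?_)
  rwa [hH.coeff_eq h]

theorem dom_closed [IsAlgClosed K] {a b : ℕ} (ha : 2 ≤ a) (hb : 2 ≤ b) (hco : a.Coprime b)
    {B : MvPolynomial (Fin 2) K} (hl : LND (jacD B)) (hB : B ≠ 0) : Dom ((a : ℝ) / b) B := by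
  set t : ℝ := a / b with ht
  have hb' : (0 : ℝ) < b := by exact_mod_cast (by omega : 0 < b)
  have ha' : (0 : ℝ) < a := by exact_mod_cast (by omega : 0 < a)
  have ht0 : 0 < t := by positivity
  have htb : t * b = a := by rw [ht]; field_simp
  obtain ⟨H, hH⟩ := exists_lead t B
  have hH0 := hH.ne_zero hB
  have hlH := hl.lead hH
  obtain ⟨d, hd⟩ := MvPolynomial.ne_zero_iff.1 hH0
  by_cases h0 : ∀ e, coeff e H ≠ 0 → e 0 ≠ 0
  · have hp := hlH.pure0 hH0 h0
    refine dom_of_lead hH hd fun e he => ?_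
    have h1 := hH.1 d hd
    have h2 := hH.1 e he
    rw [wt, hp d hd] at h1
    rw [wt, hp e he, ← h1] at h2
    have : (e 0 : ℝ) = d 0 := by
      apply mul_left_cancel₀ ht0.ne'; linarith
    exact fin2_ext (by exact_mod_cast this) (by rw [hp e he, hp d hd])
  by_cases h1 : ∀ e, coeff e H ≠ 0 → e 1 ≠ 0
  · have hp := hlH.pure1 hH0 h1
    refine dom_of_lead hH hd fun e he => ?_
    have h1 := hH.1 d hd
    have h2 := hH.1 e he
    rw [wt, hp d hd] at h1
    rw [wt, hp e he, ← h1] at h2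
    have : (e 1 : ℝ) = d 1 := by simpa using h2
    exact fin2_ext (by rw [hp e he, hp d hd]) (by exact_mod_cast this)
  push Not at h0 h1
  obtain ⟨y, hy, hy0⟩ := h0
  obtain ⟨x, hx, hx0⟩ := h1
  have wy := hH.1 y hy
  have wx := hH.1 x hx
  rw [wt, hy0] at wy
  rw [wt, hx0] at wx
  have e1 : b * y 1 = a * x 0 := by
    have : (b : ℝ) * y 1 = a * x 0 := by
      have : (y 1 : ℝ) = t * x 0 := by push_cast at wy wx; linarith
      rw [this, ← htb]; ring
    exact_mod_cast this
  obtain ⟨r, hr⟩ : a ∣ y 1 := hco.dvd_of_dvd_mul_left ⟨_, e1⟩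
  have hr' : x 0 = b * r := by
    apply Nat.eq_of_mul_eq_mul_left (show 0 < a by omega)
    rw [← e1, hr]; ring
  have hxe : x = Finsupp.single 0 (b * r) := fin2_ext (by simp [hr']) (by simp [hx0])
  have hye : y = Finsupp.single 1 (a * r) := fin2_ext (by simp [hy0]) (by simp [hr])
  have hdgr : dg t B = a * r := by rw [← wy, hr]; push_cast; ring
  have hHn : ∀ e, coeff e H ≠ 0 → a * e 0 + b * e 1 = a * b * r := by
    intro e he
    have h2 := hH.1 e he
    rw [hdgr, wt] at h2
    have : (a : ℝ) * e 0 + b * e 1 = a * b * r := by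
      have h3 : (a : ℝ) * e 0 = b * (t * e 0) := by rw [← htb]; ring
      rw [h3]; linear_combination (b : ℝ) * h2
    exact_mod_cast this
  rcases Nat.eq_zero_or_pos r with h | h
  · subst h
    have hz : ∀ e, coeff e H ≠ 0 → e = 0 := by
      intro e he
      have := hHn e he
      rw [mul_zero] at this
      have h2 : a * e 0 = 0 := by omega
      have h3 : b * e 1 = 0 := by omega
      apply fin2_ext
      · rcases Nat.mul_eq_zero.1 h2 with h | h
        · omega
        · simpa using h
      · rcases Nat.mul_eq_zero.1 h3 with h | h
        · omega
        · simpa using h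
    exact dom_of_lead hH hd fun e he => by rw [hz e he, hz d hd]
  · exact (shape ha hb h hco hHn (by rwa [← hxe]) (by rwa [← hye]) hlH).elim

/-! base change -/

variable {L : Type*} [Field L] [Algebra K L]

theorem bc_hom (τ : MvPolynomial (Fin 2) K →ₐ[K] MvPolynomial (Fin 2) K)
    (p : MvPolynomial (Fin 2) K) :
    (aeval (fun i => map (algebraMap K L) (τ (X i))) : MvPolynomial (Fin 2) L →ₐ[L] _)
      (map (algebraMap K L) p) = map (algebraMap K L) (τ p) := by
  induction p using MvPolynomial.induction_on with
  | C a =>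
    have : τ (C a) = C a := τ.commutes a
    rw [this]; simp [algebraMap_eq]
  | add p q hp hq => simp only [map_add, hp, hq]
  | mul_X p i hp => simp only [map_mul, hp, map_X, aeval_X]

/-- Base change of an automorphism. -/
noncomputable def bc (L : Type*) [Field L] [Algebra K L]
    (σ : MvPolynomial (Fin 2) K ≃ₐ[K] MvPolynomial (Fin 2) K) :
    MvPolynomial (Fin 2) L ≃ₐ[L] MvPolynomial (Fin 2) L :=
  AlgEquiv.ofAlgHom (aeval (fun i => map (algebraMap K L) (σ (X i))))
    (aeval (fun i => map (algebraMap K L) (σ.symm (X i))))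
    (by
      apply MvPolynomial.algHom_ext
      intro i
      have := bc_hom (L := L) σ.toAlgHom (σ.symm (X i))
      simp only [AlgHom.comp_apply, aeval_X, AlgHom.id_apply]
      refine this.trans ?_
      change map _ (σ (σ.symm (X i))) = _
      simp)
    (by
      apply MvPolynomial.algHom_ext
      intro i
      have := bc_hom (L := L) σ.symm.toAlgHom (σ (X i))
      simp only [AlgHom.comp_apply, aeval_X, AlgHom.id_apply]
      refine this.trans ?_
      change map _ (σ.symm (σ (X i))) = _
      simp)

theorem bc_map (σ : MvPolynomial (Fin 2) K ≃ₐ[K] MvPolynomial (Fin 2) K)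
    (p : MvPolynomial (Fin 2) K) :
    bc L σ (map (algebraMap K L) p) = map (algebraMap K L) (σ p) :=
  bc_hom (L := L) σ.toAlgHom p

theorem dg_map (t : ℝ) (p : MvPolynomial (Fin 2) K) :
    dg t (map (algebraMap K L) p) = dg t p :=
  dg_congr_support (support_map_of_injective p (algebraMap K L).injective)

theorem jac_map (p q : MvPolynomial (Fin 2) K) :
    Jac (map (algebraMap K L) p) (map (algebraMap K L) q) = map (algebraMap K L) (Jac p q) := by
  simp only [Jac, pderiv_map, map_sub, map_mul]

theorem t1 {a b : ℕ} (ha : 2 ≤ a) (hab : a < b) (hco : a.Coprime b)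
    (σ : MvPolynomial (Fin 2) K ≃ₐ[K] MvPolynomial (Fin 2) K)
    {p q : MvPolynomial (Fin 2) K} {c : K} (hc : c ≠ 0) (hJ : Jac p q = C c)
    (h : Pi' a b 1 p q) : Pi' a b 1 (σ p) (σ q) := by
  let L := AlgebraicClosure K
  have : CharZero L := charZero_of_injective_algebraMap (algebraMap K L).injective
  have h' : Pi' a b 1 (map (algebraMap K L) p) (map (algebraMap K L) q) := by
    unfold Pi' at h ⊢; rwa [dg_map, dg_map]
  have := t1_closed ha hab hco _ (bc L σ) rfl (c := algebraMap K L c)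
    (by simpa using hc) (by rw [jac_map, hJ, map_C]) h'
  rw [bc_map, bc_map] at this
  unfold Pi' at this ⊢
  rwa [dg_map, dg_map] at this

theorem dom1 {a b : ℕ} (ha : 2 ≤ a) (hb : 2 ≤ b) (hco : a.Coprime b)
    (σ : MvPolynomial (Fin 2) K ≃ₐ[K] MvPolynomial (Fin 2) K) : Dom ((a : ℝ) / b) (σ (X 1)) := by
  let L := AlgebraicClosure K
  have : CharZero L := charZero_of_injective_algebraMap (algebraMap K L).injective
  have h := dom_closed ha hb hco (LND.coord (bc L σ)) (by simp)
  have e : bc L σ (X 1) = map (algebraMap K L) (σ (X 1)) := by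
    rw [← bc_map, map_X]
  rw [e] at h
  have hs := support_map_of_injective (σ (X 1)) (algebraMap K L).injective
  have hs' : ∀ d, coeff d (map (algebraMap K L) (σ (X 1))) ≠ 0 ↔ coeff d (σ (X 1)) ≠ 0 := by
    intro d; rw [← mem_support_iff, ← mem_support_iff, hs]
  obtain ⟨d, hd, hu⟩ := h
  exact ⟨d, (hs' d).1 hd, fun e he hne => hu e ((hs' e).2 he) hne⟩

theorem dom0 {a b : ℕ} (ha : 2 ≤ a) (hb : 2 ≤ b) (hco : a.Coprime b)
    (σ : MvPolynomial (Fin 2) K ≃ₐ[K] MvPolynomial (Fin 2) K) : Dom ((a : ℝ) / b) (σ (X 0)) := by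
  have := dom1 ha hb hco ((exch K).trans σ)
  rwa [AlgEquiv.trans_apply, exch_X1] at this

end basechange


/-! ### Reduction to a pair of incommensurable degrees -/
section step0
variable {K : Type*} [Field K] [CharZero K]

theorem dg1_nat (p : MvPolynomial (Fin 2) K) : ∃ n : ℕ, dg 1 p = n := by
  by_cases hp : p = 0
  · exact ⟨0, by rw [hp, dg_zero]; simp⟩
  · obtain ⟨d, -, h⟩ := exists_dg 1 hp
    exact ⟨d 0 + d 1, by rw [h, wt]; push_cast; ring⟩

theorem ne_zero_of_jac {p q : MvPolynomial (Fin 2) K} {c : K} (hc : c ≠ 0) (hJ : Jac p q = C c) :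
    q ≠ 0 := by
  rintro rfl
  have h0 : Jac p 0 = 0 := by simp [Jac]
  rw [h0] at hJ
  exact hc (C_injective _ _ (by rw [← hJ, map_zero]))

theorem jac_symm {p q : MvPolynomial (Fin 2) K} {c : K} (hJ : Jac p q = C c) :
    Jac q p = C (-c) := by
  rw [jac_swap, hJ, map_neg]

theorem dg_pos_of_jac {p q : MvPolynomial (Fin 2) K} {c : K} (hc : c ≠ 0) (hJ : Jac p q = C c)
    {n : ℕ} (hn : dg 1 p = n) : 0 < n := by
  rcases Nat.eq_zero_or_pos n with h | h
  · have h2 : LEw 1 p 0 := by have := LEw_dg 1 p; rw [hn, h] at this; simpa using this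
    obtain ⟨e, rfl⟩ := h2.eq_C one_pos
    rw [jac_C_left] at hJ
    exact absurd (C_injective _ _ (by rw [← hJ, map_zero])) hc
  · exact h

theorem linear_form {p : MvPolynomial (Fin 2) K} (h : LEw 1 p 1) :
    ∃ α β e : K, p = C α * X 0 + C β * X 1 + C e := by
  obtain ⟨α, hα⟩ := (h.pderiv0.mono (by norm_num : (1 : ℝ) - 1 ≤ 0)).eq_C one_pos
  obtain ⟨β, hβ⟩ := (h.pderiv1.mono (by norm_num : (1 : ℝ) - 1 ≤ 0)).eq_C one_pos
  obtain ⟨e, he⟩ : ∃ e, p - C α * X 0 - C β * X 1 = C e := by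
    apply const_of_pderiv
    · rw [map_sub, map_sub, hα, pderiv_C_mul, pderiv_C_mul]; simp
    · rw [map_sub, map_sub, hβ, pderiv_C_mul, pderiv_C_mul]; simp
  exact ⟨α, β, e, by rw [← he]; ring⟩

theorem C_mem_adjoin (S : Subalgebra K (MvPolynomial (Fin 2) K)) (c : K) : C c ∈ S :=
  S.algebraMap_mem c

theorem top_of_X (S : Subalgebra K (MvPolynomial (Fin 2) K)) (h0 : X 0 ∈ S) (h1 : X 1 ∈ S) :
    S = ⊤ := by
  rw [eq_top_iff, ← MvPolynomial.adjoin_range_X, Algebra.adjoin_le_iff]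
  rintro _ ⟨i, rfl⟩
  fin_cases i
  · exact h0
  · exact h1

/-- incommensurable Jacobian pair -/
def BadPair (K : Type*) [Field K] : Prop := ∃ (P Q : MvPolynomial (Fin 2) K) (c : K) (a b d : ℕ),
  c ≠ 0 ∧ Jac P Q = C c ∧ 2 ≤ a ∧ a < b ∧ a.Coprime b ∧ 0 < d ∧
    dg 1 P = (a * d : ℕ) ∧ dg 1 Q = (b * d : ℕ)

theorem step0_aux (hno : ¬ BadPair K) (n : ℕ) : ∀ (P Q : MvPolynomial (Fin 2) K) (c : K) (m k : ℕ),
    c ≠ 0 → Jac P Q = C c → dg 1 P = m → dg 1 Q = k → m + k = n →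
    Algebra.adjoin K {P, Q} = ⊤ := by
  induction n using Nat.strong_induction_on with
  | _ n ih =>
    have main : ∀ (P Q : MvPolynomial (Fin 2) K) (c : K) (m k : ℕ),
        c ≠ 0 → Jac P Q = C c → dg 1 P = m → dg 1 Q = k → m + k = n → m ≤ k →
        Algebra.adjoin K {P, Q} = ⊤ := by
      intro P Q c m k hc hJ hm hk hmk hle
      have hP0 : P ≠ 0 := ne_zero_of_jac (neg_ne_zero.2 hc) (jac_symm hJ)
      have hQ0 : Q ≠ 0 := ne_zero_of_jac hc hJ
      have hmpos := dg_pos_of_jac hc hJ hm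
      have hPmem : P ∈ Algebra.adjoin K {P, Q} := Algebra.subset_adjoin (by simp)
      have hQmem : Q ∈ Algebra.adjoin K {P, Q} := Algebra.subset_adjoin (by simp)
      rcases Nat.lt_or_ge 2 (m + k) with h2 | h2
      · obtain ⟨g, a, b, hg, hcop, e1, e2⟩ : ∃ g a b : ℕ, 0 < g ∧ a.Coprime b ∧ m = a * g ∧
            k = b * g := by
          obtain ⟨w1, w2, h, h', h''⟩ := Nat.exists_coprime m k
          exact ⟨_, w1, w2, Nat.gcd_pos_of_pos_left _ hmpos, h, h', h''⟩
        have hab : a ≤ b := by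
          rw [e1, e2] at hle; exact Nat.le_of_mul_le_mul_right hle hg
        have ha0 : a ≠ 0 := by rintro rfl; simp at e1; omega
        have h2' : (2 : ℝ) < m + k := by exact_mod_cast h2
        rcases Nat.lt_or_ge a 2 with ha | ha
        · obtain rfl : a = 1 := by omega
          obtain rfl : m = g := by omega
          have hPi : ∀ Q' : MvPolynomial (Fin 2) K, dg 1 Q' = k → Pi' 1 b 1 P Q' := by
            intro Q' hQ'
            refine ⟨?_, ?_⟩
            · rw [hm, hQ', e2]; push_cast; ring
            · rw [hm, hQ']; linarith
          obtain ⟨v, hv⟩ := exists_vert 1 1 hP0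
          obtain ⟨w, hw⟩ := exists_vert 1 1 hQ0
          have hvert : ∀ (Q' : MvPolynomial (Fin 2) K) (z : Fin 2 →₀ ℕ), dg 1 Q' = k → Jac P Q' = C c →
              Vert 1 1 Q' z → z = b • v := by
            intro Q' z hQ' hJ' hz
            obtain ⟨x0, x1⟩ := vert_ratio one_pos (by omega) one_pos one_ne_zero hJ' (hPi Q' hQ') hv hz
            apply fin2_ext
            · simp; omega
            · simp; omega
          have hwv := hvert Q w hk hJ hw
          have hpow := hv.pow one_ne_zero b
          rw [← hwv] at hpow
          set ε := coeff w Q / coeff w (P ^ b) with hε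
          set Q' := Q - C ε * P ^ b with hQ'
          have hJ' : Jac P Q' = C c := by
            rw [hQ', jac_sub_right, jac_C_mul_right, hJ]
            have : Jac P (P ^ b) = 0 := by
              rw [jac_swap, ← jacD_apply, Derivation.leibniz_pow, jacD_apply, jac_self]; simp
            rw [this]; simp
          have hQ'0 : Q' ≠ 0 := ne_zero_of_jac hc hJ'
          have hcw : coeff w Q' = 0 := by
            rw [hQ', coeff_sub, coeff_C_mul, hε, div_mul_cancel₀ _ hpow.1, sub_self]
          have hle' : dg 1 Q' ≤ k := by
            apply dg_le hQ'0
            rw [hQ']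
            refine LEw.sub ?_ (LEw.C_mul _ ?_)
            · rw [← hk]; exact LEw_dg _ _
            · have := (LEw_dg 1 P).pow b
              rw [hm] at this
              rw [e2]; push_cast; exact this
          have hlt : dg 1 Q' < k := by
            refine lt_of_le_of_ne hle' fun he => ?_
            obtain ⟨z, hz⟩ := exists_vert 1 1 hQ'0
            have := hvert Q' z he hJ' hz
            rw [← hwv] at this
            rw [this] at hz
            exact hz.1 hcw
          obtain ⟨k', hk'⟩ := dg1_nat Q'
          rw [hk'] at hlt
          have hlt' : k' < k := by exact_mod_cast hlt
          have htop := ih (m + k') (by omega) P Q' c m k' hc hJ' hm hk' rfl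
          rw [eq_top_iff, ← htop, Algebra.adjoin_le_iff]
          rintro z (rfl | rfl)
          · exact hPmem
          · exact Subalgebra.sub_mem _ hQmem
              (Subalgebra.mul_mem _ (C_mem_adjoin _ _) (Subalgebra.pow_mem _ hPmem _))
        · exfalso
          apply hno
          have hne : a ≠ b := by
            rintro rfl
            simp at hcop; omega
          exact ⟨P, Q, c, a, b, g, hc, hJ, ha, by omega, hcop, hg, by rw [hm, e1], by rw [hk, e2]⟩
      · obtain ⟨rfl, rfl⟩ : m = 1 ∧ k = 1 := by omega
        have lP : LEw 1 P 1 := by have := LEw_dg 1 P; rw [hm] at this; simpa using this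
        have lQ : LEw 1 Q 1 := by have := LEw_dg 1 Q; rw [hk] at this; simpa using this
        obtain ⟨α, β, e, hP⟩ := linear_form lP
        obtain ⟨α', β', e', hQ⟩ := linear_form lQ
        have hdet : C (α * β' - β * α') = (C c : MvPolynomial (Fin 2) K) := by
          rw [← hJ, hP, hQ]
          simp only [Jac, map_add, pderiv_C_mul, pderiv_C, map_sub, map_mul]
          simp
        have hdet' : α * β' - β * α' = c := C_injective _ _ hdet
        have hcc : (C c⁻¹ : MvPolynomial (Fin 2) K) * C c = 1 := by
          rw [← C_mul, inv_mul_cancel₀ hc, C_1]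
        have x0 : (X 0 : MvPolynomial (Fin 2) K) =
            C c⁻¹ * (C β' * (P - C e) - C β * (Q - C e')) := by
          have : C β' * (P - C e) - C β * (Q - C e') = C c * X 0 := by
            rw [hP, hQ, ← hdet]; simp only [map_sub, map_mul]; ring
          rw [this, ← mul_assoc, hcc, one_mul]
        have x1 : (X 1 : MvPolynomial (Fin 2) K) =
            C c⁻¹ * (C α * (Q - C e') - C α' * (P - C e)) := by
          have : C α * (Q - C e') - C α' * (P - C e) = C c * X 1 := by
            rw [hP, hQ, ← hdet]; simp only [map_sub, map_mul]; ring
          rw [this, ← mul_assoc, hcc, one_mul]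
        have hmem : ∀ u v w z : K, C u * (C v * (P - C e) - C w * (Q - C e')) ∈
            Algebra.adjoin K {P, Q} := fun u v w z =>
          Subalgebra.mul_mem _ (C_mem_adjoin _ _) (Subalgebra.sub_mem _
            (Subalgebra.mul_mem _ (C_mem_adjoin _ _)
              (Subalgebra.sub_mem _ hPmem (C_mem_adjoin _ _)))
            (Subalgebra.mul_mem _ (C_mem_adjoin _ _)
              (Subalgebra.sub_mem _ hQmem (C_mem_adjoin _ _))))
        apply top_of_X
        · rw [x0]; exact hmem _ _ _ 0
        · have : C c⁻¹ * (C α * (Q - C e') - C α' * (P - C e)) =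
              C (-c⁻¹) * (C α' * (P - C e) - C α * (Q - C e')) := by
            rw [map_neg]; ring
          rw [x1, this]; exact hmem _ _ _ 0
    intro P Q c m k hc hJ hm hk hmk
    rcases le_total m k with h | h
    · exact main P Q c m k hc hJ hm hk hmk h
    · rw [Set.pair_comm]
      exact main Q P (-c) k m (neg_ne_zero.2 hc) (jac_symm hJ) hk hm (by omega) h

theorem step0 (hno : ¬ BadPair K) (f : MvPolynomial (Fin 2) K →ₐ[K] MvPolynomial (Fin 2) K) {c : K}
    (hc : c ≠ 0) (hJ : Jac (f (X 0)) (f (X 1)) = C c) : Function.Bijective f := by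
  refine ⟨jac_injective f hc hJ, ?_⟩
  obtain ⟨m, hm⟩ := dg1_nat (f (X 0))
  obtain ⟨k, hk⟩ := dg1_nat (f (X 1))
  have htop := step0_aux hno (m + k) _ _ c m k hc hJ hm hk rfl
  rw [← AlgHom.range_eq_top, eq_top_iff, ← htop, Algebra.adjoin_le_iff]
  rintro z (rfl | rfl)
  · exact ⟨X 0, rfl⟩
  · exact ⟨X 1, rfl⟩

end step0


/-! ### Degree computations for the auxiliary endomorphism -/
section step3
variable {K : Type*} [Field K] [CharZero K]

theorem dg_nonneg {t : ℝ} (ht : 0 < t) (p : MvPolynomial (Fin 2) K) : 0 ≤ dg t p := by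
  by_cases hp : p = 0
  · rw [hp, dg_zero]
  · obtain ⟨d, -, h⟩ := exists_dg t hp
    rw [h]; exact wt_nonneg ht d

/-- A factor of a product of small degree is constant. -/
theorem const_of_mul {T g : MvPolynomial (Fin 2) K} (hT : T ≠ 0) {r : ℝ} (hr : dg 1 T = r)
    (h : LEw 1 (T * g) r) : ∃ e, g = C e := by
  by_cases hg : g = 0
  · exact ⟨0, by rw [hg, map_zero]⟩
  · have h1 := dg_le (mul_ne_zero hT hg) h
    rw [dg_mul 1 hT hg] at h1
    exact LEw.eq_C ((LEw_dg 1 g).mono (by linarith)) one_pos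

theorem const_of_jac {R P τ : MvPolynomial (Fin 2) K} {c : K} (hc : c ≠ 0) (hJ : Jac R P = C c)
    (hR : 0 < dg 1 R) (h : Jac R τ = 0) (hτ : LTw 1 τ (dg 1 R)) : ∃ e, τ = C e := by
  have hR0 : R ≠ 0 := ne_zero_of_dg_pos hR
  set g := Jac τ P with hg
  have e0 : C c * pderiv 0 τ = pderiv 0 R * g := by
    rw [← hJ, hg]; unfold Jac at h ⊢
    linear_combination (pderiv 0 P) * h
  have e1 : C c * pderiv 1 τ = pderiv 1 R * g := by
    rw [← hJ, hg]; unfold Jac at h ⊢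
    linear_combination (pderiv 1 P) * h
  have hCc : (C c : MvPolynomial (Fin 2) K) ≠ 0 := by
    rw [Ne, C_eq_zero]; exact hc
  have hg0 : g = 0 := by
    by_contra hg0
    have hE : C c * (X 0 * pderiv 0 τ + X 1 * pderiv 1 τ) =
        (X 0 * pderiv 0 R + X 1 * pderiv 1 R) * g := by
      linear_combination X 0 * e0 + X 1 * e1
    have coE : ∀ (p : MvPolynomial (Fin 2) K) d,
        coeff d (X 0 * pderiv 0 p + X 1 * pderiv 1 p) = ((d 0 : K) + d 1) * coeff d p := by
      intro p d; rw [coeff_add, coeff_theta, coeff_theta]; ring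
    obtain ⟨d, hd, hdd⟩ := exists_dg 1 hR0
    have hd' : coeff d (X 0 * pderiv 0 R + X 1 * pderiv 1 R) ≠ 0 := by
      rw [coE]
      refine mul_ne_zero ?_ hd
      intro hz
      have hz' : d 0 + d 1 = 0 := by exact_mod_cast hz
      rw [hdd, wt] at hR
      have h0 : d 0 = 0 := by omega
      have h1 : d 1 = 0 := by omega
      rw [h0, h1] at hR
      simp at hR
    have hne : (X 0 * pderiv 0 R + X 1 * pderiv 1 R) ≠ 0 := by
      intro hz; rw [hz] at hd'; simp at hd'
    have l1 : dg 1 R ≤ dg 1 (X 0 * pderiv 0 R + X 1 * pderiv 1 R) := by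
      rw [hdd]; exact le_dg hd'
    have l2 := dg_mul 1 hne hg0
    have l3 : LTw 1 (C c * (X 0 * pderiv 0 τ + X 1 * pderiv 1 τ)) (dg 1 R) := by
      apply LTw.C_mul
      intro d hd
      rw [coE] at hd
      exact hτ d (right_ne_zero_of_mul hd)
    rw [hE] at l3
    have l4 := dg_lt (mul_ne_zero hne hg0) l3
    have := dg_nonneg one_pos g
    linarith
  rw [hg0, mul_zero] at e0 e1
  exact const_of_pderiv ((mul_eq_zero.1 e0).resolve_left hCc) ((mul_eq_zero.1 e1).resolve_left hCc)

theorem pow_sub_le {p q : MvPolynomial (Fin 2) K} {r s : ℝ} (hp : LEw 1 p r) (hq : LEw 1 q r)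
    (h : LEw 1 (p - q) (r - s)) (n : ℕ) : LEw 1 (p ^ n - q ^ n) (n * r - s) := by
  induction n with
  | zero => simpa using LEw.zero
  | succ n ih =>
    have e : p ^ (n + 1) - q ^ (n + 1) = p ^ n * (p - q) + (p ^ n - q ^ n) * q := by ring
    rw [e]
    refine LEw.add (((hp.pow n).mul h).mono ?_) ((ih.mul hq).mono ?_) <;> push_cast <;> linarith

/-- Rigidity of large powers. -/
theorem const_of_pow {U V : MvPolynomial (Fin 2) K} {r : ℝ} (hV0 : V ≠ 0) (hV : dg 1 V = r)
    (hUV : LTw 1 (U - V) r) (k : ℕ) (h : LEw 1 (U ^ (k + 1) - V ^ (k + 1)) (k * r)) :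
    ∃ e, U - V = C e := by
  have lV : LEw 1 V r := by rw [← hV]; exact LEw_dg _ _
  have lU : LEw 1 U r := by have := hUV.le.add lV; rwa [sub_add_cancel] at this
  set G := ∑ i ∈ Finset.range (k + 1), U ^ i * V ^ (k + 1 - 1 - i) with hG
  have hk : (C ((k : K) + 1) : MvPolynomial (Fin 2) K) ≠ 0 := by
    rw [Ne, C_eq_zero]; exact_mod_cast Nat.succ_ne_zero k
  have hk' : ((k : K) + 1) ≠ 0 := by exact_mod_cast Nat.succ_ne_zero k
  have hlow : LTw 1 (G - C ((k : K) + 1) * V ^ k) (k * r) := by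
    have e : G - C ((k : K) + 1) * V ^ k =
        ∑ i ∈ Finset.range (k + 1), (U ^ i - V ^ i) * V ^ (k - i) := by
      have : C ((k : K) + 1) * V ^ k = ∑ i ∈ Finset.range (k + 1), V ^ k := by
        rw [Finset.sum_const, Finset.card_range, nsmul_eq_mul]; simp
      rw [hG, this, ← Finset.sum_sub_distrib]
      refine Finset.sum_congr rfl fun i hi => ?_
      have hi' : i ≤ k := by simpa [Nat.lt_succ_iff] using hi
      have : V ^ k = V ^ i * V ^ (k - i) := by rw [← pow_add]; congr 1; omega
      rw [this, sub_mul]; rfl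
    rw [e]
    refine LTw.sum _ _ fun i hi => ?_
    have hi' : i ≤ k := by simpa [Nat.lt_succ_iff] using hi
    refine ((pow_sub_lt lU lV hUV i).mul_le (lV.pow (k - i))).mono ?_
    rw [Nat.cast_sub hi']; apply le_of_eq; ring
  have hVk : V ^ k ≠ 0 := pow_ne_zero _ hV0
  have hm0 : C ((k : K) + 1) * V ^ k ≠ 0 := mul_ne_zero hk hVk
  have hmd : dg 1 (C ((k : K) + 1) * V ^ k) = k * r := by
    rw [dg_C_mul 1 hk' hVk, dg_pow 1 hV0, hV]
  have eG : G = C ((k : K) + 1) * V ^ k + (G - C ((k : K) + 1) * V ^ k) := by ring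
  rw [← hmd] at hlow
  have hG0 : G ≠ 0 := by rw [eG]; exact add_ne_zero_of_lt hm0 hlow
  have hGd : dg 1 G = k * r := by rw [eG, dg_add_lt hm0 hlow, hmd]
  apply const_of_mul hG0 hGd
  rwa [hG, geom_sum₂_mul]

noncomputable def RR (b : ℕ) (P Q : MvPolynomial (Fin 2) K) : MvPolynomial (Fin 2) K :=
  P ^ (b + 4) + (Q + P ^ (b + 2) + P ^ (b + 1))

noncomputable def SS (b : ℕ) (P Q : MvPolynomial (Fin 2) K) : MvPolynomial (Fin 2) K :=
  RR b P Q ^ 2 + P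

noncomputable def FF (b : ℕ) (P Q : MvPolynomial (Fin 2) K) :
    MvPolynomial (Fin 2) K →ₐ[K] MvPolynomial (Fin 2) K := aeval ![SS b P Q, RR b P Q]

theorem FF_X0 (b : ℕ) (P Q : MvPolynomial (Fin 2) K) : FF b P Q (X 0) = SS b P Q := by simp [FF]
theorem FF_X1 (b : ℕ) (P Q : MvPolynomial (Fin 2) K) : FF b P Q (X 1) = RR b P Q := by simp [FF]

theorem FF_map (δ : MvPolynomial (Fin 2) K ≃ₐ[K] MvPolynomial (Fin 2) K) (b : ℕ)
    (P Q A : MvPolynomial (Fin 2) K) : δ (FF b P Q A) = FF b (δ P) (δ Q) A := by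
  have : δ.toAlgHom.comp (FF b P Q) = FF b (δ P) (δ Q) := by
    apply MvPolynomial.algHom_ext
    intro i
    fin_cases i
    · change δ (FF b P Q (X 0)) = FF b (δ P) (δ Q) (X 0)
      rw [FF_X0, FF_X0]; simp [SS, RR]
    · change δ (FF b P Q (X 1)) = FF b (δ P) (δ Q) (X 1)
      rw [FF_X1, FF_X1]; simp [RR]
  exact DFunLike.congr_fun this A

section degs
variable {b : ℕ} {P Q : MvPolynomial (Fin 2) K} {m : ℝ}

theorem RR_low (hm : 0 < m) (hP : dg 1 P = m) (hQ : LTw 1 Q ((b + 1) * m)) :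
    LTw 1 (RR b P Q - P ^ (b + 4)) ((b + 4) * m) := by
  have lP : LEw 1 P m := by rw [← hP]; exact LEw_dg _ _
  have e : RR b P Q - P ^ (b + 4) = Q + P ^ (b + 2) + P ^ (b + 1) := by unfold RR; ring
  rw [e]
  refine ((hQ.mono ?_).add ((lP.pow _).lt ?_)).add ((lP.pow _).lt ?_)
  · nlinarith
  · push_cast; nlinarith
  · push_cast; nlinarith

theorem RR_dg (hm : 0 < m) (hP : dg 1 P = m) (hQ : LTw 1 Q ((b + 1) * m)) :
    dg 1 (RR b P Q) = (b + 4) * m ∧ RR b P Q ≠ 0 := by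
  have hP0 : P ≠ 0 := ne_zero_of_dg_pos (t := 1) (by rw [hP]; exact hm)
  have hd : dg 1 (P ^ (b + 4)) = (b + 4) * m := by rw [dg_pow 1 hP0, hP]; push_cast; ring
  have h := RR_low hm hP hQ
  rw [← hd] at h
  have e : RR b P Q = P ^ (b + 4) + (RR b P Q - P ^ (b + 4)) := by ring
  have hn : P ^ (b + 4) ≠ 0 := pow_ne_zero _ hP0
  have : dg 1 (RR b P Q) = (b + 4) * m := by rw [e, dg_add_lt hn h, hd]
  refine ⟨this, ne_zero_of_dg_pos (t := 1) ?_⟩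
  rw [this]; positivity

theorem SS_dg (hm : 0 < m) (hP : dg 1 P = m) (hQ : LTw 1 Q ((b + 1) * m)) :
    dg 1 (SS b P Q) = 2 * ((b + 4) * m) ∧ SS b P Q ≠ 0 := by
  obtain ⟨h1, h2⟩ := RR_dg hm hP hQ
  have lP : LEw 1 P m := by rw [← hP]; exact LEw_dg _ _
  have hn : RR b P Q ^ 2 ≠ 0 := pow_ne_zero _ h2
  have hd : dg 1 (RR b P Q ^ 2) = 2 * ((b + 4) * m) := by rw [dg_pow 1 h2, h1]; push_cast; ring
  have hl : LTw 1 P (dg 1 (RR b P Q ^ 2)) := by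
    rw [hd]; refine lP.lt ?_
    have : (0 : ℝ) ≤ b := by positivity
    nlinarith
  have : dg 1 (SS b P Q) = 2 * ((b + 4) * m) := by rw [SS, dg_add_lt hn hl, hd]
  refine ⟨this, ne_zero_of_dg_pos (t := 1) ?_⟩
  rw [this]; positivity

theorem FF_dg (hm : 0 < m) (hP : dg 1 P = m) (hQ : LTw 1 Q ((b + 1) * m))
    {A : MvPolynomial (Fin 2) K} {M : ℕ} (hA : LEw 1 A M) (hc : coeff (Finsupp.single 0 M) A ≠ 0) :
    dg 1 (FF b P Q A) = M * (2 * ((b + 4) * m)) ∧ FF b P Q A ≠ 0 := by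
  obtain ⟨h1, h2⟩ := RR_dg hm hP hQ
  obtain ⟨h3, h4⟩ := SS_dg hm hP hQ
  have := comp_dom (f := FF b P Q) (A := A) (s := 1) (t := 2) (μ := (b + 4) * m) (by positivity)
    (by rw [FF_X0, h3]) (by rw [FF_X1, h1]) (by rw [FF_X0]; exact h4) hc (by
      intro e he hne
      have l := hA e he
      rw [wt_single0]
      unfold wt at l ⊢
      have l' : e 0 + e 1 ≤ M := by
        have : ((e 0 + e 1 : ℕ) : ℝ) ≤ M := by push_cast; linarith
        exact_mod_cast this
      have : 2 * e 0 + e 1 < 2 * M := by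
        by_contra hcon
        apply hne
        apply fin2_ext
        · simp; omega
        · simp; omega
      exact_mod_cast this)
  rw [wt_single0] at this
  refine ⟨?_, this.2⟩
  rw [this.1]; ring

theorem FF_le (hm : 0 < m) (hP : dg 1 P = m) (hQ : LTw 1 Q ((b + 1) * m))
    {A : MvPolynomial (Fin 2) K} {s : ℝ} (hA : LEw 2 A s) :
    LEw 1 (FF b P Q A) ((b + 4) * m * s) := by
  obtain ⟨h1, h2⟩ := RR_dg hm hP hQ
  obtain ⟨h3, h4⟩ := SS_dg hm hP hQ
  refine comp_le (t := 2) (by positivity) ?_ ?_ hA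
  · rw [FF_X0, ← h3]; exact LEw_dg _ _
  · rw [FF_X1, ← h1]; exact LEw_dg _ _

theorem LEw_two {A : MvPolynomial (Fin 2) K} {s : ℝ} (hA : LEw 1 A s) : LEw 2 A (2 * s) := by
  intro d hd
  have := hA d hd
  unfold wt at this ⊢
  have : (0 : ℝ) ≤ d 1 := by positivity
  linarith

noncomputable def TT (b : ℕ) (P Q A : MvPolynomial (Fin 2) K) : MvPolynomial (Fin 2) K :=
  C 2 * RR b P Q * FF b P Q (pderiv 0 A) + FF b P Q (pderiv 1 A)

theorem TT_dg (hm : 0 < m) (hP : dg 1 P = m) (hQ : LTw 1 Q ((b + 1) * m))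
    {A : MvPolynomial (Fin 2) K} {M : ℕ} (hA : LEw 1 A (M + 1 : ℕ))
    (hc : coeff (Finsupp.single 0 (M + 1)) A ≠ 0) :
    dg 1 (TT b P Q A) = (b + 4) * m + M * (2 * ((b + 4) * m)) ∧ TT b P Q A ≠ 0 := by
  obtain ⟨h1, h2⟩ := RR_dg hm hP hQ
  have l0 : LEw 1 (pderiv 0 A) M := hA.pderiv0.mono (by push_cast; linarith)
  have l1 : LEw 1 (pderiv 1 A) M := hA.pderiv1.mono (by push_cast; linarith)
  have hc' : coeff (Finsupp.single 0 M) (pderiv 0 A) ≠ 0 := by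
    have h := coeff_theta 0 (Finsupp.single 0 (M + 1)) A
    have e : (Finsupp.single 0 (M + 1) : Fin 2 →₀ ℕ) = Finsupp.single 0 1 + Finsupp.single 0 M := by
      rw [← Finsupp.single_add, add_comm]
    intro hz
    rw [e, coeff_X_mul, hz, ← e] at h
    refine mul_ne_zero ?_ hc h.symm
    simp; exact_mod_cast Nat.succ_ne_zero M
  obtain ⟨h5, h6⟩ := FF_dg hm hP hQ l0 hc'
  have l2 := FF_le hm hP hQ (LEw_two l1)
  have hC2 : (2 : K) ≠ 0 := two_ne_zero
  have hn : C 2 * RR b P Q * FF b P Q (pderiv 0 A) ≠ 0 :=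
    mul_ne_zero (mul_ne_zero (by rw [Ne, C_eq_zero]; exact hC2) h2) h6
  have hd : dg 1 (C 2 * RR b P Q * FF b P Q (pderiv 0 A)) =
      (b + 4) * m + M * (2 * ((b + 4) * m)) := by
    rw [mul_assoc, dg_C_mul 1 hC2 (mul_ne_zero h2 h6), dg_mul 1 h2 h6, h1, h5]
  have hl : LTw 1 (FF b P Q (pderiv 1 A)) (dg 1 (C 2 * RR b P Q * FF b P Q (pderiv 0 A))) := by
    rw [hd]; refine l2.lt ?_
    have : 0 < (b + 4) * m := by positivity
    nlinarith
  exact ⟨by rw [TT, dg_add_lt hn hl, hd], add_ne_zero_of_lt hn hl⟩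

theorem jac_FF (b : ℕ) (P Q A G : MvPolynomial (Fin 2) K) : Jac (FF b P Q A) G =
    TT b P Q A * Jac (RR b P Q) G + FF b P Q (pderiv 0 A) * Jac P G := by
  rw [jac_hom_left, FF_X0, FF_X1, SS, jac_add_left]
  have : Jac (RR b P Q ^ 2) G = C 2 * RR b P Q * Jac (RR b P Q) G := by
    rw [← jacD_apply, Derivation.leibniz_pow, jacD_apply]
    have h2 : (C 2 : MvPolynomial (Fin 2) K) = 2 := map_ofNat C 2
    rw [h2]
    simp [mul_assoc]
  rw [this, TT]; ring

theorem FF_top (hm : 0 < m) (hP : dg 1 P = m) (hQ : LTw 1 Q ((b + 1) * m))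
    {A : MvPolynomial (Fin 2) K} {M : ℕ} (hA : LEw 1 A M) :
    LEw 1 (FF b P Q A - C (coeff (Finsupp.single 0 M) A) * RR b P Q ^ (2 * M))
      ((2 * M - 1) * ((b + 4) * m)) := by
  obtain ⟨h1, h2⟩ := RR_dg hm hP hQ
  obtain ⟨h3, h4⟩ := SS_dg hm hP hQ
  have lP : LEw 1 P m := by rw [← hP]; exact LEw_dg _ _
  have lR : LEw 1 (RR b P Q) ((b + 4) * m) := by rw [← h1]; exact LEw_dg _ _
  have lS : LEw 1 (SS b P Q) (2 * ((b + 4) * m)) := by rw [← h3]; exact LEw_dg _ _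
  set l := coeff (Finsupp.single 0 M) A with hl
  set A' := A - C l * X 0 ^ M with hA'
  have la : LEw 2 A' (2 * M - 1) := by
    intro e he
    have hm' : (C l * X 0 ^ M : MvPolynomial (Fin 2) K) = monomial (Finsupp.single 0 M) l := by
      rw [← C_mul_X_pow_eq_monomial]
    rw [hA', coeff_sub, hm', coeff_monomial] at he
    have hne : Finsupp.single 0 M ≠ e := by
      rintro rfl
      rw [if_pos rfl, hl, sub_self] at he
      exact he rfl
    rw [if_neg hne, sub_zero] at he
    have l := hA e he
    unfold wt at l ⊢
    have l' : e 0 + e 1 ≤ M := by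
      have : ((e 0 + e 1 : ℕ) : ℝ) ≤ M := by push_cast; linarith
      exact_mod_cast this
    have : 2 * e 0 + e 1 + 1 ≤ 2 * M := by
      by_contra hcon
      apply hne
      apply fin2_ext
      · simp; omega
      · simp; omega
    have : ((2 * e 0 + e 1 + 1 : ℕ) : ℝ) ≤ (2 * M : ℕ) := by exact_mod_cast this
    push_cast at this; linarith
  have e : FF b P Q A - C l * RR b P Q ^ (2 * M) =
      FF b P Q A' + C l * (SS b P Q ^ M - (RR b P Q ^ 2) ^ M) := by
    have : FF b P Q (C l) = C l := (FF b P Q).commutes l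
    rw [hA', map_sub, map_mul, map_pow, FF_X0, this, pow_mul]; ring
  rw [e]
  refine LEw.add ((FF_le hm hP hQ la).mono (by linarith)) (LEw.C_mul _ ?_)
  have hd : LEw 1 (SS b P Q - RR b P Q ^ 2) (2 * ((b + 4) * m) - (b + 4) * m) := by
    have : SS b P Q - RR b P Q ^ 2 = P := by unfold SS; ring
    rw [this]; refine lP.mono ?_
    have : (0 : ℝ) ≤ b := by positivity
    nlinarith
  refine (pow_sub_le lS ((lR.pow 2).mono (by push_cast; linarith)) hd M).mono ?_
  apply le_of_eq; ring

end degs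

theorem poly_dg {P : MvPolynomial (Fin 2) K} {m : ℝ} (hm : 0 < m) (hP : dg 1 P = m)
    {w : Polynomial K} (hw : w ≠ 0) : dg 1 (Polynomial.aeval P w) = w.natDegree * m := by
  have hP0 : P ≠ 0 := ne_zero_of_dg_pos (t := 1) (by rw [hP]; exact hm)
  have lP : LEw 1 P m := by rw [← hP]; exact LEw_dg _ _
  have hl : w.leadingCoeff ≠ 0 := Polynomial.leadingCoeff_ne_zero.2 hw
  have hn : P ^ w.natDegree ≠ 0 := pow_ne_zero _ hP0
  have hd : dg 1 (C w.leadingCoeff * P ^ w.natDegree) = w.natDegree * m := by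
    rw [dg_C_mul 1 hl hn, dg_pow 1 hP0, hP]
  have e : Polynomial.aeval P w = C w.leadingCoeff * P ^ w.natDegree +
      ∑ i ∈ Finset.range w.natDegree, C (w.coeff i) * P ^ i := by
    rw [Polynomial.aeval_eq_sum_range, Finset.sum_range_succ, add_comm]
    simp only [MvPolynomial.smul_eq_C_mul]; rfl
  rw [e, dg_add_lt (mul_ne_zero (by rw [Ne, C_eq_zero]; exact hl) hn), hd]
  rw [hd]
  refine LTw.sum _ _ fun i hi => LTw.C_mul _ ((lP.pow i).lt ?_)
  have : i < w.natDegree := by simpa using hi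
  have : (i : ℝ) < w.natDegree := by exact_mod_cast this
  nlinarith

theorem poly_coeff {P : MvPolynomial (Fin 2) K} {m : ℝ} (hm : 0 < m) (hP : dg 1 P = m)
    {w : Polynomial K} {j : ℕ} (h : LTw 1 (Polynomial.aeval P w) (j * m)) {i : ℕ} (hi : j ≤ i) :
    w.coeff i = 0 := by
  by_cases hw : w = 0
  · rw [hw, Polynomial.coeff_zero]
  · apply Polynomial.coeff_eq_zero_of_natDegree_lt
    refine lt_of_lt_of_le ?_ hi
    have hd := poly_dg hm hP hw
    have hj : w.natDegree * m < j * m ∨ Polynomial.aeval P w = 0 := by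
      by_cases hz : Polynomial.aeval P w = 0
      · exact Or.inr hz
      · left; rw [← hd]; exact dg_lt hz h
    rcases hj with hj | hj
    · exact_mod_cast lt_of_mul_lt_mul_right hj hm.le
    · exfalso
      rw [hj, dg_zero] at hd
      have hd0 : w.natDegree = 0 := by
        have : (w.natDegree : ℝ) = 0 := by
          rcases mul_eq_zero.1 hd.symm with h | h
          · exact h
          · linarith
        exact_mod_cast this
      rw [Polynomial.eq_C_of_natDegree_eq_zero hd0] at hj hw
      rw [Polynomial.aeval_C] at hj
      apply hw
      have : (C (w.coeff 0) : MvPolynomial (Fin 2) K) = 0 := hj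
      rw [C_eq_zero] at this
      rw [this, map_zero]

theorem kappa {P Q Q' : MvPolynomial (Fin 2) K} {m : ℝ} {b : ℕ} (hm : 0 < m) (hP : dg 1 P = m)
    (hQ : LTw 1 Q ((b + 1) * m)) (hQ' : LTw 1 Q' ((b + 1) * m)) {κ κ₀ ρ : K} (hκ : κ ≠ 0)
    (h : RR b (C κ * P + C κ₀) Q' = C (κ ^ (b + 4)) * RR b P Q + C ρ) : κ = 1 ∧ κ₀ = 0 := by
  set r := κ₀ / κ with hr
  have hκ₀ : κ₀ = κ * r := by rw [hr]; field_simp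
  set ω := κ ^ (b + 4) with hω
  let w : Polynomial K := Polynomial.C ω * (Polynomial.X ^ (b + 4) + Polynomial.X ^ (b + 2) + Polynomial.X ^ (b + 1)) -
    (Polynomial.C ω * (Polynomial.X + Polynomial.C r) ^ (b + 4) + Polynomial.C (κ ^ (b + 2)) * (Polynomial.X + Polynomial.C r) ^ (b + 2) +
      Polynomial.C (κ ^ (b + 1)) * (Polynomial.X + Polynomial.C r) ^ (b + 1))
  have hC : ∀ z : K, Polynomial.aeval P (Polynomial.C z) = (C z : MvPolynomial (Fin 2) K) :=
    fun z => Polynomial.aeval_C _ _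
  have hw : Polynomial.aeval P w = Q' - C ω * Q - C ρ := by
    simp only [w, map_sub, map_add, map_mul, map_pow, Polynomial.aeval_X, hC]
    unfold RR at h
    rw [hκ₀, C_mul, ← mul_add] at h
    simp only [mul_pow] at h
    rw [hω, map_pow] at h ⊢
    linear_combination (-1 : MvPolynomial (Fin 2) K) * h
  have hl : LTw 1 (Polynomial.aeval P w) ((b + 1 : ℕ) * m) := by
    rw [hw]; push_cast
    refine (hQ'.sub (hQ.C_mul _)).sub ((HOM.C ρ).le.lt (by positivity))
  have co : ∀ i, b + 1 ≤ i → w.coeff i = 0 := fun i hi => poly_coeff hm hP hl hi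
  have hω0 : ω ≠ 0 := pow_ne_zero _ hκ
  have c3 := co (b + 3) (by omega)
  have c2 := co (b + 2) (by omega)
  have c1 := co (b + 1) (by omega)
  simp only [w, Polynomial.coeff_sub, Polynomial.coeff_add, Polynomial.coeff_C_mul,
    Polynomial.coeff_X_pow, Polynomial.coeff_X_add_C_pow] at c3 c2 c1
  have hr0 : r = 0 := by
    have e1 : Nat.choose (b + 2) (b + 3) = 0 := Nat.choose_eq_zero_of_lt (by omega)
    have e2 : Nat.choose (b + 1) (b + 3) = 0 := Nat.choose_eq_zero_of_lt (by omega)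
    have e3 : Nat.choose (b + 4) (b + 3) = b + 4 := Nat.choose_succ_self_right (b + 3)
    have e4 : b + 4 - (b + 3) = 1 := by omega
    rw [e1, e2, e3, e4] at c3
    simp at c3
    rcases c3 with c3 | c3 | c3
    · exact absurd c3 hω0
    · exact c3
    · exfalso
      have : ((b + 4 : ℕ) : K) = 0 := by push_cast; exact c3
      exact absurd (Nat.cast_eq_zero.1 this) (by omega)
  rw [hr0] at c2 c1
  have z1 : b + 4 - (b + 2) = 2 := by omega
  have z2 : b + 4 - (b + 1) = 3 := by omega
  have z3 : b + 2 - (b + 1) = 1 := by omega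
  rw [z1] at c2
  rw [z2, z3] at c1
  have e1 : Nat.choose (b + 1) (b + 2) = 0 := Nat.choose_eq_zero_of_lt (by omega)
  rw [e1] at c2
  simp [sub_eq_zero] at c2 c1
  have hk1 : κ = 1 := by
    have h1 : κ ^ (b + 1) ≠ 0 := pow_ne_zero _ hκ
    have : κ ^ (b + 1) * κ = κ ^ (b + 1) * 1 := by
      rw [← pow_succ, mul_one, ← c1, c2]
    exact mul_left_cancel₀ h1 this
  exact ⟨hk1, by rw [hκ₀, hr0, mul_zero]⟩

end step3


/-! ### The linear change of coordinates and the final contradiction -/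
section final
variable {K : Type*} [Field K] [CharZero K]

theorem aeval_mono (v : Fin 2 → Polynomial K) (d : Fin 2 →₀ ℕ) (c : K) :
    aeval v (monomial d c) = Polynomial.C c * (v 0 ^ d 0 * v 1 ^ d 1) := by
  rw [aeval_monomial, Finsupp.prod_fintype _ _ (by simp), Fin.prod_univ_two]; rfl

theorem coeff_x0 (p : MvPolynomial (Fin 2) K) (n : ℕ) : coeff (Finsupp.single 0 n) p =
    (aeval (![Polynomial.X, 0] : Fin 2 → Polynomial K) p).coeff n := by
  induction p using MvPolynomial.induction_on' with
  | monomial d c =>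
    rw [aeval_mono, coeff_monomial, Polynomial.coeff_C_mul]
    by_cases h1 : d 1 = 0
    · by_cases h0 : d 0 = n
      · have : d = Finsupp.single 0 n := fin2_ext (by simpa using h0) (by simpa using h1)
        rw [if_pos this]; simp [h1, h0]
      · have : d ≠ Finsupp.single 0 n := by rintro rfl; simp at h0
        have h0' : n ≠ d 0 := fun h => h0 h.symm
        rw [if_neg this]; simp [h1, Polynomial.coeff_X_pow, h0']
    · have : d ≠ Finsupp.single 0 n := by rintro rfl; simp at h1
      rw [if_neg this]; simp [h1]
  | add p q hp hq => rw [coeff_add, map_add, Polynomial.coeff_add, hp, hq]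

theorem outer_poly {A : MvPolynomial (Fin 2) K} (hA : A ≠ 0) {m : ℕ} (hm : dg 1 A = m) :
    ∃ w : Polynomial K, w ≠ 0 ∧ ∀ β : K,
      coeff (Finsupp.single 0 m) (aeval ![X 0, X 1 + C β * X 0] A : MvPolynomial (Fin 2) K) =
        w.eval β := by
  classical
  obtain ⟨d, hd, hdd⟩ := exists_dg 1 hA
  have hdm : d 0 + d 1 = m := by
    rw [hm, wt] at hdd
    have : ((d 0 + d 1 : ℕ) : ℝ) = m := by push_cast; linarith
    exact_mod_cast this
  refine ⟨∑ e ∈ A.support, if e 0 + e 1 = m then Polynomial.monomial (e 1) (coeff e A) else 0,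
    ?_, fun β => ?_⟩
  · intro hz
    have h := congrArg (fun w => Polynomial.coeff w (d 1)) hz
    simp only [Polynomial.finset_sum_coeff, Polynomial.coeff_zero] at h
    rw [Finset.sum_eq_single d] at h
    · rw [if_pos hdm, Polynomial.coeff_monomial, if_pos rfl] at h
      exact hd h
    · intro e _ hne
      split_ifs with he
      · rw [Polynomial.coeff_monomial, if_neg]
        intro h1
        exact hne (fin2_ext (by omega) h1)
      · simp
    · intro hd'; exact absurd (mem_support_iff.2 hd) hd'
  · rw [coeff_x0]
    have hcomp : aeval (![Polynomial.X, 0] : Fin 2 → Polynomial K)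
        (aeval ![X 0, X 1 + C β * X 0] A : MvPolynomial (Fin 2) K) =
        aeval (![Polynomial.X, Polynomial.C β * Polynomial.X] : Fin 2 → Polynomial K) A := by
      have : (aeval (![Polynomial.X, 0] : Fin 2 → Polynomial K)).comp
          (aeval ![X 0, X 1 + C β * X 0] : MvPolynomial (Fin 2) K →ₐ[K] MvPolynomial (Fin 2) K) =
          aeval (![Polynomial.X, Polynomial.C β * Polynomial.X] : Fin 2 → Polynomial K) := by
        apply MvPolynomial.algHom_ext
        intro i
        fin_cases i
        · simp
        · simp
      exact DFunLike.congr_fun this A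
    rw [hcomp]
    conv_lhs => rw [A.as_sum]
    rw [map_sum, Polynomial.finset_sum_coeff, Polynomial.eval_finset_sum]
    refine Finset.sum_congr rfl fun e _ => ?_
    rw [aeval_mono]
    have : Polynomial.C (coeff e A) * ((![Polynomial.X, Polynomial.C β * Polynomial.X] :
        Fin 2 → Polynomial K) 0 ^ e 0 * (![Polynomial.X, Polynomial.C β * Polynomial.X] :
        Fin 2 → Polynomial K) 1 ^ e 1) =
        Polynomial.C (coeff e A * β ^ e 1) * Polynomial.X ^ (e 0 + e 1) := by
      simp [mul_pow, pow_add]; ring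
    rw [this, Polynomial.coeff_C_mul, Polynomial.coeff_X_pow]
    by_cases he : e 0 + e 1 = m
    · rw [if_pos he, if_pos he.symm]; simp
    · rw [if_neg he, if_neg (Ne.symm he)]; simp

theorem outer {P Q : MvPolynomial (Fin 2) K} {c : K} (hc : c ≠ 0) (hJ : Jac P Q = C c) {m n : ℕ}
    (hm : dg 1 P = m) (hn : dg 1 Q = n) : ∃ p₀ q₀ : MvPolynomial (Fin 2) K, Jac p₀ q₀ = C c ∧
      LEw 1 p₀ m ∧ LEw 1 q₀ n ∧ coeff (Finsupp.single 0 m) p₀ ≠ 0 ∧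
      coeff (Finsupp.single 0 n) q₀ ≠ 0 := by
  have hP0 : P ≠ 0 := ne_zero_of_jac (neg_ne_zero.2 hc) (jac_symm hJ)
  have hQ0 : Q ≠ 0 := ne_zero_of_jac hc hJ
  obtain ⟨w, hw, h1⟩ := outer_poly hP0 hm
  obtain ⟨w', hw', h1'⟩ := outer_poly hQ0 hn
  obtain ⟨β, hβ⟩ : ∃ β, (w * w').eval β ≠ 0 := by
    by_contra hcon
    push Not at hcon
    exact mul_ne_zero hw hw' (Polynomial.funext fun r => by rw [hcon r, Polynomial.eval_zero])
  rw [Polynomial.eval_mul] at hβ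
  let σ : MvPolynomial (Fin 2) K →ₐ[K] MvPolynomial (Fin 2) K := aeval ![X 0, X 1 + C β * X 0]
  have s0 : σ (X 0) = X 0 := by simp [σ]
  have s1 : σ (X 1) = X 1 + C β * X 0 := by simp [σ]
  have l0 : LEw 1 (σ (X 0)) (1 * 1) := by rw [s0, mul_one]; exact HOM.X0.le
  have l1 : LEw 1 (σ (X 1)) 1 := by rw [s1]; exact HOM.X1.le.add (HOM.X0.le.C_mul _)
  refine ⟨σ P, σ Q, ?_, ?_, ?_, ?_, ?_⟩
  · have : σ (C c) = C c := σ.commutes c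
    rw [jac_hom, hJ, s0, s1, this, jac_add_right, jac_C_mul_right, jac_self, jac_X]; simp
  · have := comp_le (f := σ) (t := 1) zero_le_one l0 l1 (LEw_dg 1 P)
    rwa [one_mul, hm] at this
  · have := comp_le (f := σ) (t := 1) zero_le_one l0 l1 (LEw_dg 1 Q)
    rwa [one_mul, hn] at this
  · rw [h1]; exact left_ne_zero_of_mul hβ
  · rw [h1']; exact right_ne_zero_of_mul hβ

theorem linear_of_le {t : ℝ} (ht : 0 < t) (ht1 : t < 1) {A : MvPolynomial (Fin 2) K}
    (h : LEw t A t) : ∃ ε e : K, A = C ε * X 0 + C e := by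
  have h1 : pderiv 1 A = 0 := h.pderiv1.eq_zero ht (by linarith)
  obtain ⟨ε, h0⟩ := LEw.eq_C (h.pderiv0.mono (by linarith : t - t ≤ 0)) ht
  obtain ⟨e, he⟩ : ∃ e, A - C ε * X 0 = C e := by
    apply const_of_pderiv
    · rw [map_sub, h0, pderiv_C_mul]; simp
    · rw [map_sub, h1, pderiv_C_mul]; simp
  exact ⟨ε, e, by rw [← he]; ring⟩

/-- First half: `δ` preserves `g x` up to an affine map. -/
theorem first_half {a b : ℕ} (ha : 2 ≤ a) (hab : a < b) (hco : a.Coprime b) {M N : ℕ} {d : ℕ}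
    (hd : 0 < d) (hM : M = a * d) (hN : N = b * d) {r r' : ℝ} (hr : 0 < r) (hr' : 0 < r')
    (g : MvPolynomial (Fin 2) K →ₐ[K] MvPolynomial (Fin 2) K)
    (γ δ : MvPolynomial (Fin 2) K ≃ₐ[K] MvPolynomial (Fin 2) K)
    (hγ : ∀ p, γ (γ p) = p) (hgd : ∀ p, g (γ p) = δ (g p))
    (g0 : dg 1 (g (X 0)) = M * r) (g1 : dg 1 (g (X 1)) = N * r)
    (d0 : dg 1 (δ (g (X 0))) = M * r') (d1 : dg 1 (δ (g (X 1))) = N * r') :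
    r' = r ∧ ∃ ε e : K, ε ≠ 0 ∧ δ (g (X 0)) = C ε * g (X 0) + C e := by
  have hb' : (0 : ℝ) < b := by exact_mod_cast (by omega : 0 < b)
  have ha' : (0 : ℝ) < a := by exact_mod_cast (by omega : 0 < a)
  have hab' : (a : ℝ) < b := by exact_mod_cast hab
  have hd' : (0 : ℝ) < d := by exact_mod_cast hd
  have hM' : (M : ℝ) = a * d := by rw [hM]; push_cast; rfl
  have hN' : (N : ℝ) = b * d := by rw [hN]; push_cast; rfl
  set t : ℝ := (a : ℝ) / b with ht
  have ht0 : 0 < t := by positivity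
  have ht1 : t < 1 := by rw [ht, div_lt_one hb']; exact hab'
  have htb : t * b = a := by rw [ht]; field_simp
  have hMN : (M : ℝ) = t * N := by rw [hM', hN', ← htb]; ring
  have hNpos : (0 : ℝ) < N := by rw [hN']; positivity
  have hμ : 0 < N * r := by positivity
  have hg00 : g (X 0) ≠ 0 := ne_zero_of_dg_pos (t := 1) (by rw [g0, hM']; positivity)
  have key : ∀ A : MvPolynomial (Fin 2) K, Dom t A → dg 1 (g A) = N * r * dg t A := by
    rintro A ⟨e, he, hdom⟩
    have h := (comp_dom (f := g) (s := 1) (t := t) (μ := N * r) hμ (by rw [g0, hMN]; ring) g1 hg00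
      he hdom).1
    rw [h, dg_eq he]
    intro e' he'
    by_cases h' : e' = e
    · rw [h']
    · exact (hdom e' he' h').le
  have hA := key _ (dom0 ha (by omega) hco γ)
  have hB := key _ (dom1 ha (by omega) hco γ)
  rw [hgd, d0] at hA
  rw [hgd, d1] at hB
  set α := dg t (γ (X 0)) with hα
  set β := dg t (γ (X 1)) with hβ
  have hαβ : α = t * β := by
    have : N * r * α = N * r * (t * β) := by
      rw [← hA, hMN]; linear_combination t * hB
    exact mul_left_cancel₀ hμ.ne' this
  have hβ1 : β ≤ 1 := by
    by_contra hcon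
    push Not at hcon
    have hPi : Pi' a b t (γ (X 0)) (γ (X 1)) := by
      refine ⟨?_, ?_⟩
      · rw [← hα, ← hβ, hαβ]; linear_combination β * htb
      · rw [← hα, ← hβ, hαβ]; nlinarith
    obtain ⟨c, hc, hJ⟩ := jac_equiv γ
    have h1 := slemma ha hab hco hc hJ ht0 hPi one_pos
    have h2 := t1 ha hab hco γ hc hJ h1
    rw [hγ, hγ] at h2
    have x0 : dg 1 (X 0 : MvPolynomial (Fin 2) K) ≤ 1 := dg_le (X_ne_zero _) HOM.X0.le
    have x1 : dg 1 (X 1 : MvPolynomial (Fin 2) K) ≤ 1 := dg_le (X_ne_zero _) HOM.X1.le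
    have := h2.2
    linarith
  have hαt : α ≤ t := by rw [hαβ]; nlinarith
  obtain ⟨ε, e, hAe⟩ := linear_of_le ht0 ht1 ((LEw_dg t (γ (X 0))).mono (by rw [← hα]; exact hαt))
  have hε : ε ≠ 0 := by
    rintro rfl
    obtain ⟨c, hc, hJ⟩ := jac_equiv γ
    rw [hAe, map_zero, zero_mul, zero_add, jac_C_left] at hJ
    exact hc (C_injective _ _ (by rw [← hJ, map_zero]))
  have hform : δ (g (X 0)) = C ε * g (X 0) + C e := by
    have hC : ∀ z : K, g (C z) = C z := fun z => g.commutes z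
    rw [← hgd, hAe, map_add, map_mul, hC, hC]
  refine ⟨?_, ε, e, hε, hform⟩
  have hεn : C ε * g (X 0) ≠ 0 := mul_ne_zero (by rw [Ne, C_eq_zero]; exact hε) hg00
  have hεd : dg 1 (C ε * g (X 0)) = M * r := by rw [dg_C_mul 1 hε hg00, g0]
  have hMpos : (0 : ℝ) < M := by rw [hM']; positivity
  rw [hform, dg_add_lt hεn (by rw [hεd]; exact (HOM.C e).le.lt (by positivity)), hεd] at d0
  exact (mul_left_cancel₀ hMpos.ne' d0).symm

set_option maxHeartbeats 1600000 in
/-- Second half: `δ` fixes `P` and `Q`. -/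
theorem second_half {b M : ℕ} {P Q A : MvPolynomial (Fin 2) K} {c : K} (hc : c ≠ 0)
    (hJ : Jac P Q = C c) {m : ℝ} (hm : 0 < m) (hP : dg 1 P = m) (hQ : LTw 1 Q ((b + 1) * m))
    (δ : MvPolynomial (Fin 2) K ≃ₐ[K] MvPolynomial (Fin 2) K) (hδ : ∀ p, δ (δ p) = p)
    (hP' : dg 1 (δ P) = m) (hQ' : LTw 1 (δ Q) ((b + 1) * m))
    (hA : LEw 1 A (M + 1 : ℕ)) (hcA : coeff (Finsupp.single 0 (M + 1)) A ≠ 0)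
    {ε e : K} (hε : ε ≠ 0) (h : δ (FF b P Q A) = C ε * FF b P Q A + C e) :
    δ P = P ∧ δ Q = Q := by
  set R := RR b P Q with hR
  set R' := RR b (δ P) (δ Q) with hR'
  obtain ⟨Rd, R0⟩ := RR_dg hm hP hQ
  obtain ⟨Rd', R0'⟩ := RR_dg hm hP' hQ'
  rw [← hR] at Rd R0
  rw [← hR'] at Rd' R0'
  set r : ℝ := (b + 4) * m with hr
  have hrpos : 0 < r := by positivity
  have hmr : 2 * m ≤ r := by
    have : (0 : ℝ) ≤ b := by positivity
    rw [hr]; nlinarith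
  have lP : LEw 1 P m := by rw [← hP]; exact LEw_dg _ _
  have lP' : LEw 1 (δ P) m := by rw [← hP']; exact LEw_dg _ _
  have lR : LEw 1 R r := by rw [← Rd]; exact LEw_dg _ _
  have lR' : LEw 1 R' r := by rw [← Rd']; exact LEw_dg _ _
  have hpow : ∀ n : ℕ, Jac (P ^ n) P = 0 := by
    intro n
    rw [← jacD_apply, Derivation.leibniz_pow, jacD_apply, jac_self]; simp
  have hRP : Jac R P = C (-c) := by
    rw [hR, RR, jac_add_left, jac_add_left, jac_add_left, hpow, hpow, hpow, jac_symm hJ]; ring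
  obtain ⟨T1, T2⟩ := TT_dg hm hP hQ hA hcA
  obtain ⟨T1', T2'⟩ := TT_dg hm hP' hQ' hA hcA
  -- `Jac R (δ P)` is constant
  have hconst : ∃ k, Jac R (δ P) = C k := by
    apply const_of_mul T2 T1
    obtain ⟨cδ, -, hcδ⟩ := jac_equiv δ
    have hCδ : ∀ z : K, δ (C z) = C z := fun z => δ.commutes z
    have e1 : Jac (δ (FF b P Q A)) (δ P) = C (-c * cδ) * TT b (δ P) (δ Q) A := by
      have e2 : Jac (δ (FF b P Q A)) (δ P) = δ (Jac (FF b P Q A) P) * Jac (δ (X 0)) (δ (X 1)) :=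
        jac_hom δ.toAlgHom _ _
      have e3 : δ (TT b P Q A) = TT b (δ P) (δ Q) A := by
        have e4 : δ (RR b P Q) = RR b (δ P) (δ Q) := by simp [RR]
        rw [TT, map_add, map_mul, map_mul, hCδ, FF_map, FF_map, e4, TT]
      rw [e2, jac_FF, jac_self, mul_zero, add_zero, ← hR, hRP, hcδ, map_mul, hCδ, e3, C_mul]; ring
    rw [h, jac_add_left, jac_C_left, add_zero, jac_C_mul_left, jac_FF, ← hR] at e1
    have hε' : (C ε⁻¹ : MvPolynomial (Fin 2) K) * C ε = 1 := by
      rw [← C_mul, inv_mul_cancel₀ hε, C_1]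
    have e5 : TT b P Q A * Jac R (δ P) = C ε⁻¹ * (C (-c * cδ) * TT b (δ P) (δ Q) A) -
        FF b P Q (pderiv 0 A) * Jac P (δ P) := by
      rw [← e1, ← mul_assoc, hε']; ring
    rw [e5]
    refine LEw.sub (LEw.C_mul _ (LEw.C_mul _ ?_)) ?_
    · rw [← T1']; exact LEw_dg _ _
    · have l0 : LEw 1 (pderiv 0 A) M := hA.pderiv0.mono (by push_cast; linarith)
      refine ((FF_le hm hP hQ (LEw_two l0)).mul (lP.jac lP')).mono ?_
      rw [← hr]; linarith
  -- hence `δ P` is affine in `P`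
  obtain ⟨k, hk⟩ := hconst
  obtain ⟨κ, κ₀, hκP⟩ : ∃ κ κ₀ : K, δ P = C κ * P + C κ₀ := by
    set κ := k / (-c) with hκ
    have hcz : Jac R (δ P - C κ * P) = 0 := by
      rw [jac_sub_right, jac_C_mul_right, hRP, hk, ← C_mul, ← C_sub, hκ,
        div_mul_cancel₀ _ (neg_ne_zero.2 hc), sub_self, map_zero]
    obtain ⟨κ₀, h0⟩ := const_of_jac (neg_ne_zero.2 hc) hRP (by rw [Rd]; exact hrpos) hcz (by
      rw [Rd]
      exact (lP'.sub (lP.C_mul _)).lt (by linarith))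
    exact ⟨κ, κ₀, by rw [← h0]; ring⟩
  have hκ : κ ≠ 0 := by
    rintro rfl
    rw [hκP, map_zero, zero_mul, zero_add, dg_C] at hP'
    linarith
  set ω := κ ^ (b + 4) with hω
  have hω0 : ω ≠ 0 := pow_ne_zero _ hκ
  clear_value ω
  have hCω : (C ω : MvPolynomial (Fin 2) K) ≠ 0 := by rw [Ne, C_eq_zero]; exact hω0
  have hωR : LTw 1 (R' - C ω * R) r := by
    have h1 := RR_low hm hP hQ
    have h2 := RR_low hm hP' hQ'
    have h3 := pow_sub_lt lP' (lP.C_mul κ) (by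
      rw [hκP, add_sub_cancel_left]; exact (HOM.C κ₀).le.lt hm) (b + 4)
    rw [← hR, ← hr] at h1
    rw [← hR', ← hr] at h2
    have h3' : LTw 1 ((δ P) ^ (b + 4) - (C κ * P) ^ (b + 4)) r := h3.mono (by
      rw [hr]; push_cast; exact le_rfl)
    have e6 : R' - C ω * R = (R' - (δ P) ^ (b + 4)) + ((δ P) ^ (b + 4) - (C κ * P) ^ (b + 4)) -
        C ω * (R - P ^ (b + 4)) := by
      rw [hω, map_pow, mul_pow]; ring
    rw [e6]
    exact (h2.add h3').sub (h1.C_mul _)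
  -- rigidity
  obtain ⟨ρ, hρ⟩ : ∃ ρ, R' - C ω * R = C ρ := by
    have t1 := FF_top hm hP hQ hA
    have t2 := FF_top hm hP' hQ' hA
    rw [← hR, ← hr] at t1
    rw [← hR', ← hr] at t2
    set l := coeff (Finsupp.single 0 (M + 1)) A with hl
    have hCl : (C l⁻¹ : MvPolynomial (Fin 2) K) * C l = 1 := by
      rw [← C_mul, inv_mul_cancel₀ hcA, C_1]
    rw [← FF_map, h] at t2
    have hkr : (2 * ((M + 1 : ℕ) : ℝ) - 1) * r = ((2 * M + 1 : ℕ) : ℝ) * r := by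
      push_cast; ring
    rw [hkr] at t1 t2
    have hd : LEw 1 (R' ^ (2 * (M + 1)) - C ε * R ^ (2 * (M + 1))) (((2 * M + 1 : ℕ) : ℝ) * r) := by
      have e7 : R' ^ (2 * (M + 1)) - C ε * R ^ (2 * (M + 1)) =
          C l⁻¹ * (C ε * (FF b P Q A - C l * R ^ (2 * (M + 1))) -
            (C ε * FF b P Q A + C e - C l * R' ^ (2 * (M + 1))) + C e) := by
        linear_combination (C ε * R ^ (2 * (M + 1)) - R' ^ (2 * (M + 1))) * hCl
      rw [e7]
      exact LEw.C_mul _ (((t1.C_mul _).sub t2).add ((HOM.C e).le.mono (by positivity)))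
    have hεω : ε = ω ^ (2 * (M + 1)) := by
      by_contra hne
      have h1 := pow_sub_lt lR' (lR.C_mul ω) hωR (2 * (M + 1))
      have h2 : LTw 1 (R' ^ (2 * (M + 1)) - C ε * R ^ (2 * (M + 1)))
          (((2 * (M + 1) : ℕ) : ℝ) * r) := hd.lt (by push_cast; linarith)
      have h3 := h2.sub h1
      have e8 : R' ^ (2 * (M + 1)) - C ε * R ^ (2 * (M + 1)) -
          (R' ^ (2 * (M + 1)) - (C ω * R) ^ (2 * (M + 1))) =
          C (ω ^ (2 * (M + 1)) - ε) * R ^ (2 * (M + 1)) := by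
        rw [C_sub, C_pow, mul_pow]; ring
      rw [e8] at h3
      have hne' : ω ^ (2 * (M + 1)) - ε ≠ 0 := fun hz => hne (sub_eq_zero.1 hz).symm
      have hRn : R ^ (2 * (M + 1)) ≠ 0 := pow_ne_zero _ R0
      have h4 := dg_lt (mul_ne_zero (by rw [Ne, C_eq_zero]; exact hne') hRn) h3
      rw [dg_C_mul 1 hne' hRn, dg_pow 1 R0, Rd] at h4
      exact lt_irrefl _ h4
    refine const_of_pow (mul_ne_zero hCω R0) (by rw [dg_C_mul 1 hω0 R0, Rd]) hωR (2 * M + 1) ?_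
    have e9 : 2 * M + 1 + 1 = 2 * (M + 1) := by ring
    rw [e9, mul_pow, ← C_pow, ← hεω]
    exact hd
  have hR'' : R' = C ω * R + C ρ := by rw [← hρ]; ring
  obtain ⟨k1, k0⟩ := kappa (Q' := δ Q) hm hP hQ hQ' hκ (ρ := ρ) (κ₀ := κ₀) (by
    rw [← hκP, ← hω, ← hR', ← hR]; exact hR'')
  have hPP : δ P = P := by rw [hκP, k1, k0]; simp
  refine ⟨hPP, ?_⟩
  have hω1 : ω = 1 := by rw [hω, k1, one_pow]
  have hQQ : δ Q = Q + C ρ := by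
    rw [hω1, hR', hR, hPP, RR, RR] at hR''
    rw [C_1] at hR''
    linear_combination hR''
  have h2 := hδ Q
  have hCδ : δ (C ρ) = C ρ := δ.commutes ρ
  rw [hQQ, map_add, hQQ, hCδ] at h2
  have h3 : C (ρ + ρ) = (C 0 : MvPolynomial (Fin 2) K) := by
    rw [C_add, C_0]; linear_combination h2
  have h4 : ρ = 0 := by
    have := C_injective _ _ h3
    have h5 : (2 : K) * ρ = 0 := by rw [two_mul]; exact this
    exact (mul_eq_zero.1 h5).resolve_left two_ne_zero
  rw [hQQ, h4, map_zero, add_zero]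

theorem no_bad
    (H : ∀ f : MvPolynomial (Fin 2) K →ₐ[K] MvPolynomial (Fin 2) K,
        (∃ c : K, c ≠ 0 ∧ Jac (f (X 0)) (f (X 1)) = C c) →
        ∃ γ δ : MvPolynomial (Fin 2) K ≃ₐ[K] MvPolynomial (Fin 2) K,
          IsInvolution γ ∧ IsInvolution δ ∧ ∀ p, f (γ p) = δ (f p)) : ¬ BadPair K := by
  rintro ⟨P, Q, c, a, b, d, hc, hJ, ha, hab, hco, hd, hP, hQ⟩
  obtain ⟨p₀, q₀, hJ0, lp, lq, cp, cq⟩ := outer hc hJ hP hQ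
  let h : MvPolynomial (Fin 2) K →ₐ[K] MvPolynomial (Fin 2) K := aeval ![p₀, q₀]
  have hx0 : h (X 0) = p₀ := by simp [h]
  have hx1 : h (X 1) = q₀ := by simp [h]
  let g : MvPolynomial (Fin 2) K →ₐ[K] MvPolynomial (Fin 2) K := (FF b P Q).comp h
  have g0 : g (X 0) = FF b P Q p₀ := by rw [← hx0]; rfl
  have g1 : g (X 1) = FF b P Q q₀ := by rw [← hx1]; rfl
  have hpow : ∀ n : ℕ, Jac P (P ^ n) = 0 := by
    intro n
    rw [jac_swap, ← jacD_apply, Derivation.leibniz_pow, jacD_apply, jac_self]; simp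
  have hSR : Jac (SS b P Q) (RR b P Q) = C c := by
    have e1 : Jac (RR b P Q ^ 2) (RR b P Q) = 0 := by
      rw [← jacD_apply, Derivation.leibniz_pow, jacD_apply, jac_self]; simp
    rw [SS, jac_add_left, e1, RR, jac_add_right, jac_add_right, jac_add_right, hpow, hpow, hpow, hJ]
    ring
  have hJg : Jac (g (X 0)) (g (X 1)) = C (c * c) := by
    have : FF b P Q (C c) = C c := (FF b P Q).commutes c
    rw [g0, g1, jac_hom, hJ0, FF_X0, FF_X1, hSR, this, C_mul]
  have hcc : c * c ≠ 0 := mul_ne_zero hc hc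
  obtain ⟨γ, δ, ⟨hγ, hγ1⟩, ⟨hδ, -⟩, hgd⟩ := H g ⟨c * c, hcc, hJg⟩
  have ha' : (2 : ℝ) ≤ a := by exact_mod_cast ha
  have hab' : (a : ℝ) < b := by exact_mod_cast hab
  have hd' : (1 : ℝ) ≤ d := by exact_mod_cast hd
  have hPi : Pi' a b 1 P Q := by
    refine ⟨?_, ?_⟩
    · rw [hP, hQ]; push_cast; ring
    · rw [hP, hQ]; push_cast; nlinarith
  have hPi' := t1 ha hab hco δ hc hJ hPi
  have small : ∀ p q : MvPolynomial (Fin 2) K, Pi' a b 1 p q → LTw 1 q ((b + 1) * dg 1 p) := by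
    intro p q hp
    obtain ⟨h1, h2⟩ := Pi'.pos (by omega) (by omega) one_pos hp
    refine (LEw_dg 1 q).lt ?_
    have := hp.1
    nlinarith
  have hm : 0 < dg 1 P := (Pi'.pos (by omega) (by omega) one_pos hPi).1
  have hm' : 0 < dg 1 (δ P) := (Pi'.pos (by omega) (by omega) one_pos hPi').1
  have sQ := small _ _ hPi
  have sQ' := small _ _ hPi'
  obtain ⟨hrr, ε, e, hε, hform⟩ := first_half ha hab hco hd rfl rfl
    (r := 2 * ((b + 4) * dg 1 P)) (r' := 2 * ((b + 4) * dg 1 (δ P))) (by positivity) (by positivity)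
    g γ δ hγ hgd (by rw [g0]; exact (FF_dg hm rfl sQ lp cp).1)
    (by rw [g1]; exact (FF_dg hm rfl sQ lq cq).1)
    (by rw [g0, FF_map]; exact (FF_dg hm' rfl sQ' lp cp).1)
    (by rw [g1, FF_map]; exact (FF_dg hm' rfl sQ' lq cq).1)
  have hmm : dg 1 (δ P) = dg 1 P := by
    have hb4 : (0 : ℝ) < b + 4 := by positivity
    have : (b + 4 : ℝ) * dg 1 (δ P) = (b + 4) * dg 1 P := by linarith
    exact mul_left_cancel₀ hb4.ne' this
  obtain ⟨M, hM⟩ : ∃ M, a * d = M + 1 :=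
    ⟨a * d - 1, by have : 0 < a * d := Nat.mul_pos (by omega) hd
                   omega⟩
  rw [hM] at lp cp
  rw [g0] at hform
  rw [hmm] at sQ'
  obtain ⟨fP, fQ⟩ := second_half hc hJ hm rfl sQ δ hδ hmm sQ' lp cp hε hform
  apply hγ1
  ext1 p
  apply jac_injective g hcc hJg
  rw [hgd]
  change δ (FF b P Q (h p)) = FF b P Q (h p)
  rw [FF_map, fP, fQ]

end final


/-- The Jacobian conjecture is equivalent to the `γ,δ` conjecture. -/
theorem stmt2 {K : Type*} [Field K] [CharZero K] :
    (∀ f : MvPolynomial (Fin 2) K →ₐ[K] MvPolynomial (Fin 2) K,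
        (∃ c : K, c ≠ 0 ∧ Jac (f (X 0)) (f (X 1)) = C c) →
        Function.Bijective f) ↔
    (∀ f : MvPolynomial (Fin 2) K →ₐ[K] MvPolynomial (Fin 2) K,
        (∃ c : K, c ≠ 0 ∧ Jac (f (X 0)) (f (X 1)) = C c) →
        ∃ γ δ : MvPolynomial (Fin 2) K ≃ₐ[K] MvPolynomial (Fin 2) K,
          IsInvolution γ ∧ IsInvolution δ ∧ ∀ p, f (γ p) = δ (f p)) := by
  constructor
  · intro H f hf
    let F : MvPolynomial (Fin 2) K ≃ₐ[K] MvPolynomial (Fin 2) K := AlgEquiv.ofBijective f (H f hf)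
    have hF : ∀ p, F p = f p := fun p => rfl
    have hne : (X 1 : MvPolynomial (Fin 2) K) ≠ X 0 := fun h => by
      have := X_injective h
      simp at this
    refine ⟨exch K, (F.symm.trans (exch K)).trans F, ⟨exch_exch, ?_⟩, ⟨fun p => ?_, ?_⟩,
      fun p => ?_⟩
    · intro h
      have h1 := DFunLike.congr_fun h (X 0 : MvPolynomial (Fin 2) K)
      rw [exch_X0] at h1
      exact hne h1
    · simp only [AlgEquiv.trans_apply, AlgEquiv.symm_apply_apply, exch_exch,
        AlgEquiv.apply_symm_apply]
    · intro h
      have h1 := DFunLike.congr_fun h (F (X 0))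
      simp only [AlgEquiv.trans_apply, AlgEquiv.symm_apply_apply, exch_X0] at h1
      exact hne (F.injective h1)
    · rw [← hF, ← hF]
      simp only [AlgEquiv.trans_apply, AlgEquiv.symm_apply_apply]
  · rintro H f ⟨c, hc, hJ⟩
    exact step0 (no_bad H) f hc hJ
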